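/- arXiv:1309.5190 — 4 statements merged into one kernel-verified Lean document; each statement's English description precedes it below -/
import Mathlib

section
/- Let (X, 𝒯) be a topological space and 𝓑 a basis of open sets of X. Then: (1) the 𝓑-ultrafilter topology on X is finer than or equal to 𝒯; (2) if (X, 𝒯) is T₀, then the 𝓑-ultrafilter topology is Hausdorff and totally disconnected; (3) if (X, 𝒯) is T₀ and the 𝓑-ultrafilter topology is compact, then the 𝓑-ultrafilter topology is the coarsest topology on X in which every member of 𝓑 is clopen, and (X, 𝒯) is a spectral space. -/
open Set

universe u

/-- The ultrafilter limit set `Y_𝓕(𝒰)`. -/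
def uLim {X : Type*} (𝓕 : Set (Set X)) (Y : Set X) (𝒰 : Ultrafilter Y) : Set X :=
  {x : X | ∀ F ∈ 𝓕, x ∈ F ↔ (Subtype.val ⁻¹' F : Set Y) ∈ 𝒰}

/-- A subset `Y ⊆ X` is `𝓕`-stable under ultrafilters if `Y_𝓕(𝒰) ⊆ Y` for every
ultrafilter `𝒰` on `Y`. -/
def UStable {X : Type*} (𝓕 : Set (Set X)) (Y : Set X) : Prop :=
  ∀ 𝒰 : Ultrafilter Y, uLim 𝓕 Y 𝒰 ⊆ Y

/-- A topological space is spectral if it is homeomorphic to the prime spectrum of some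
commutative ring, endowed with the Zariski topology. -/
def IsSpectral {X : Type u} (t : TopologicalSpace X) : Prop :=
  ∃ (A : Type u) (_ : CommRing A),
    Nonempty (@Homeomorph X (PrimeSpectrum A) t PrimeSpectrum.zariskiTopology)

namespace Hoch

noncomputable section

/-- The base field of rational functions. -/
abbrev K (σ : Type u) : Type u := FractionRing (MvPolynomial σ ℚ)

variable {σ : Type u}

/-- The variables. -/
def T (i : σ) : K σ := algebraMap (MvPolynomial σ ℚ) (K σ) (MvPolynomial.X i)

/-- Weighted substitution, polynomial version. -/
def P (w : σ → ℕ) : MvPolynomial σ ℚ →+* Polynomial (K σ) :=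
  MvPolynomial.eval₂Hom (Polynomial.C.comp (algebraMap ℚ (K σ)))
    (fun i => Polynomial.C (T i) * Polynomial.X ^ (w i))

lemma P_C (w : σ → ℕ) (a : ℚ) :
    P w (MvPolynomial.C a) = Polynomial.C (algebraMap ℚ (K σ) a) := by simp [P]

lemma P_X (w : σ → ℕ) (i : σ) :
    P w (MvPolynomial.X i) = Polynomial.C (T i) * Polynomial.X ^ (w i) := by simp [P]

lemma eval_P (w : σ → ℕ) (p : MvPolynomial σ ℚ) :
    (P w p).eval 1 = algebraMap (MvPolynomial σ ℚ) (K σ) p := by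
  induction p using MvPolynomial.induction_on with
  | C a =>
    rw [P_C, Polynomial.eval_C]
    exact IsScalarTower.algebraMap_apply ℚ (MvPolynomial σ ℚ) (K σ) a
  | add p q hp hq => simp [hp, hq]
  | mul_X p i hp => simp [hp, P_X, T]

lemma P_injective (w : σ → ℕ) : Function.Injective (P w) := by
  intro p q h
  apply IsFractionRing.injective (MvPolynomial σ ℚ) (K σ)
  rw [← eval_P w, ← eval_P w, h]

lemma P_bound (p : MvPolynomial σ ℚ) :
    ∃ M : ℕ, ∀ w : σ → ℕ, (∀ i, w i ≤ 1) → (P w p).natDegree ≤ M := by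
  induction p using MvPolynomial.induction_on with
  | C a => exact ⟨0, fun w _ => by rw [P_C]; simp⟩
  | add p q hp hq =>
    obtain ⟨M, hM⟩ := hp
    obtain ⟨N, hN⟩ := hq
    refine ⟨max M N, fun w hw => ?_⟩
    rw [map_add]
    exact (Polynomial.natDegree_add_le _ _).trans (max_le_max (hM w hw) (hN w hw))
  | mul_X p i hp =>
    obtain ⟨M, hM⟩ := hp
    refine ⟨M + 1, fun w hw => ?_⟩
    rw [map_mul, P_X]
    refine Polynomial.natDegree_mul_le.trans (add_le_add (hM w hw) ?_)
    exact (Polynomial.natDegree_C_mul_X_pow_le _ _).trans (hw i)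

/-- Polynomials as Laurent series. -/
def toL : Polynomial (K σ) →+* LaurentSeries (K σ) :=
  (HahnSeries.ofPowerSeries ℤ (K σ)).comp Polynomial.coeToPowerSeries.ringHom

lemma toL_injective : Function.Injective (toL (σ := σ)) := by
  intro p q h
  exact Polynomial.coe_injective _ (HahnSeries.ofPowerSeries_injective h)

lemma toL_coeff (p : Polynomial (K σ)) (n : ℕ) : (toL p).coeff (n : ℤ) = p.coeff n := by
  simp [toL]

lemma toL_C (a : K σ) : toL (Polynomial.C a) = HahnSeries.C a := by
  simp [toL]

lemma toL_X : toL (Polynomial.X : Polynomial (K σ)) = HahnSeries.single 1 1 := by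
  simp [toL]

/-- The weighted substitution on rational functions. -/
def φ (w : σ → ℕ) : K σ →+* LaurentSeries (K σ) :=
  IsFractionRing.lift (A := MvPolynomial σ ℚ) (g := toL.comp (P w))
    (toL_injective.comp (P_injective w))

lemma φ_alg (w : σ → ℕ) (p : MvPolynomial σ ℚ) :
    φ w (algebraMap _ (K σ) p) = toL (P w p) := by
  simp [φ]

/-- The weighted valuation. -/
def v (w : σ → ℕ) : AddValuation (K σ) (WithTop ℤ) :=
  (HahnSeries.addVal ℤ (K σ)).comap (φ w)

lemma v_apply (w : σ → ℕ) (z : K σ) : v w z = (φ w z).orderTop := rfl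

/-- The subfield of elements unaffected by the substitution. -/
def E (w : σ → ℕ) : Subfield (K σ) := (φ w).eqLocusField HahnSeries.C

lemma v_E {w : σ → ℕ} {z : K σ} (h : z ∈ E w) (hz : z ≠ 0) : v w z = 0 := by
  have h' : φ w z = HahnSeries.C z := h
  rw [v_apply, h', HahnSeries.C_apply, HahnSeries.orderTop_single hz]; rfl

lemma v_E_nonneg {w : σ → ℕ} {z : K σ} (h : z ∈ E w) : 0 ≤ v w z := by
  by_cases hz : z = 0
  · simp [hz]
  · rw [v_E h hz]

lemma T_ne (i : σ) : T i ≠ 0 := by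
  intro h
  have := IsFractionRing.injective (MvPolynomial σ ℚ) (K σ) (h.trans (map_zero _).symm)
  exact MvPolynomial.X_ne_zero i this

lemma T_mem {w : σ → ℕ} {i : σ} (h : w i = 0) : T i ∈ E w := by
  change φ w (T i) = HahnSeries.C (T i)
  rw [T, φ_alg, P_X, h, pow_zero, mul_one, toL_C]; rfl

lemma v_T {w : σ → ℕ} {i : σ} (h : w i = 1) : 0 < v w (T i) := by
  have : φ w (T i) = HahnSeries.single 1 (T i) := by
    rw [T, φ_alg, P_X, h, pow_one, map_mul, toL_C, toL_X]; simp [T]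
  rw [v_apply, this, HahnSeries.orderTop_single (T_ne i)]
  exact_mod_cast zero_lt_one

lemma v_poly_nonneg (w : σ → ℕ) (p : MvPolynomial σ ℚ) :
    0 ≤ v w (algebraMap _ (K σ) p) := by
  induction p using MvPolynomial.induction_on with
  | C a =>
    apply v_E_nonneg
    change φ w _ = HahnSeries.C _
    rw [φ_alg, P_C, toL_C]
    rw [IsScalarTower.algebraMap_apply ℚ (MvPolynomial σ ℚ) (K σ) a]; rfl
  | add p q hp hq => rw [map_add]; exact (v w).map_le_add hp hq
  | mul_X p i hp =>
    rw [map_mul, (v w).map_mul]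
    refine add_nonneg hp ?_
    rw [v_apply, φ_alg, P_X, map_mul, map_pow, toL_C, toL_X]
    simp only [HahnSeries.single_pow, HahnSeries.C_apply, HahnSeries.single_mul_single]
    refine le_trans ?_ HahnSeries.orderTop_single_le
    norm_cast
    simp

lemma v_bound (z : K σ) (hz : z ≠ 0) :
    ∃ M : ℕ, ∀ w : σ → ℕ, (∀ i, w i ≤ 1) → v w z ≤ ((M : ℤ) : WithTop ℤ) := by
  obtain ⟨p, q, hq, rfl⟩ := IsFractionRing.div_surjective (A := MvPolynomial σ ℚ) z
  have hq0 : algebraMap _ (K σ) q ≠ 0 := by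
    intro h; rw [h] at hz; simp at hz
  have hp0 : p ≠ 0 := by
    rintro rfl; simp at hz
  obtain ⟨M, hM⟩ := P_bound p
  refine ⟨M, fun w hw => ?_⟩
  have h1 : v w (algebraMap _ (K σ) p / algebraMap _ (K σ) q) + v w (algebraMap _ (K σ) q)
      = v w (algebraMap _ (K σ) p) := by
    rw [← (v w).map_mul, div_mul_cancel₀ _ hq0]
  have h2 : v w (algebraMap _ (K σ) p) ≤ ((M : ℤ) : WithTop ℤ) := by
    have hP : P w p ≠ 0 := fun h => hp0 (P_injective w (h.trans (map_zero _).symm))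
    have : (toL (P w p)).coeff ((P w p).natDegree : ℤ) ≠ 0 := by
      rw [toL_coeff]; simpa using hP
    rw [v_apply, φ_alg]
    refine (HahnSeries.orderTop_le_of_coeff_ne_zero this).trans ?_
    exact_mod_cast hM w hw
  calc _ ≤ _ := le_add_of_nonneg_right (v_poly_nonneg w q)
    _ = _ := h1
    _ ≤ _ := h2

lemma T_pow_inj (i : σ) : Function.Injective (fun n : ℕ => (T i) ^ n) := by
  intro m n h
  simp only [T, ← map_pow] at h
  have := IsFractionRing.injective (MvPolynomial σ ℚ) (K σ) h
  have := congrArg MvPolynomial.totalDegree this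
  simpa using this

variable {X : Type u}

open Classical in
/-- The weight attached to a point. -/
def wt (𝓑 : Set (Set X)) (x : X) : Option 𝓑 → ℕ
  | none => 0
  | some B => if x ∈ (B : Set X) then 0 else 1

lemma wt_le (𝓑 : Set (Set X)) (x : X) (i : Option 𝓑) : wt 𝓑 x i ≤ 1 := by
  cases i with
  | none => simp [wt]
  | some B => simp only [wt]; split_ifs <;> simp

/-- `y` is a generization of `x`. -/
def Gen (𝓑 : Set (Set X)) (y x : X) : Prop := ∀ B ∈ 𝓑, x ∈ B → y ∈ B

/-- The ring of functions whose spectrum is `X`. -/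
def A [TopologicalSpace X] (𝓑 : Set (Set X)) : Subring (X → K (Option 𝓑)) where
  carrier := {f | IsLocallyConstant f ∧ (∀ x, f x ∈ E (wt 𝓑 x)) ∧
    ∀ x y, Gen 𝓑 y x → 0 < v (wt 𝓑 x) (f y - f x)}
  zero_mem' := ⟨IsLocallyConstant.zero, fun x => zero_mem _, fun x y _ => by simp⟩
  one_mem' := ⟨IsLocallyConstant.one, fun x => one_mem _, fun x y _ => by simp⟩
  add_mem' := by
    rintro f g ⟨f1, f2, f3⟩ ⟨g1, g2, g3⟩
    refine ⟨f1.add g1, fun x => add_mem (f2 x) (g2 x), fun x y h => ?_⟩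
    have : (f + g) y - (f + g) x = (f y - f x) + (g y - g x) := by
      simp only [Pi.add_apply]; ring
    rw [this]
    exact (v _).map_lt_add (f3 x y h) (g3 x y h)
  neg_mem' := by
    rintro f ⟨f1, f2, f3⟩
    refine ⟨f1.neg, fun x => neg_mem (f2 x), fun x y h => ?_⟩
    have : (-f) y - (-f) x = -(f y - f x) := by
      simp only [Pi.neg_apply]; ring
    rw [this, (v _).map_neg]
    exact f3 x y h
  mul_mem' := by
    rintro f g ⟨f1, f2, f3⟩ ⟨g1, g2, g3⟩
    refine ⟨f1.mul g1, fun x => mul_mem (f2 x) (g2 x), fun x y h => ?_⟩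
    have : (f * g) y - (f * g) x = (f y - f x) * (g y - g x) + (f y - f x) * g x
        + f x * (g y - g x) := by
      simp only [Pi.mul_apply]; ring
    rw [this]
    refine (v _).map_lt_add ((v _).map_lt_add ?_ ?_) ?_ <;> rw [(v _).map_mul]
    · exact add_pos_of_pos_of_nonneg (f3 x y h) (g3 x y h).le
    · exact add_pos_of_pos_of_nonneg (f3 x y h) (v_E_nonneg (g2 x))
    · rw [add_comm]; exact add_pos_of_pos_of_nonneg (g3 x y h) (v_E_nonneg (f2 x))

variable [TopologicalSpace X] {𝓑 : Set (Set X)}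

lemma mem_A {f : X → K (Option 𝓑)} : f ∈ A 𝓑 ↔ IsLocallyConstant f ∧ (∀ x, f x ∈ E (wt 𝓑 x)) ∧
    ∀ x y, Gen 𝓑 y x → 0 < v (wt 𝓑 x) (f y - f x) := Iff.rfl

open Classical in
lemma ind_mem (B : 𝓑) (hB : IsClopen (B : Set X)) :
    (fun x => if x ∈ (B : Set X) then T (some B) else 0 : X → K (Option 𝓑)) ∈ A 𝓑 := by
  refine ⟨?_, fun x => ?_, fun x y h => ?_⟩
  · rw [IsLocallyConstant.iff_eventually_eq]
    intro x
    by_cases hx : x ∈ (B : Set X)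
    · filter_upwards [hB.isOpen.mem_nhds hx] with y hy
      simp [hx, hy]
    · filter_upwards [hB.compl.isOpen.mem_nhds hx] with y hy
      have hy' : y ∉ (B : Set X) := hy
      simp [hx, hy']
  · by_cases hx : x ∈ (B : Set X)
    · simp only [hx, if_true]; exact T_mem (by simp [wt, hx])
    · simp only [hx, if_false]; exact zero_mem _
  · by_cases hx : x ∈ (B : Set X)
    · simp [hx, h B B.2 hx]
    · by_cases hy : y ∈ (B : Set X)
      · simp only [hx, hy, if_true, if_false, sub_zero]
        exact v_T (by simp [wt, hx])
      · simp [hx, hy]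

lemma t_mem (m : ℕ) : (fun _ => T none ^ m : X → K (Option 𝓑)) ∈ A 𝓑 := by
  refine ⟨IsLocallyConstant.const _, fun x => pow_mem (T_mem (w := wt 𝓑 x) (i := none) rfl) m, fun x y h => by simp⟩

lemma gen_ne {f : X → K (Option 𝓑)} (hf : f ∈ A 𝓑) {x y : X} (h : Gen 𝓑 y x) (hx : f x ≠ 0) :
    v (wt 𝓑 x) (f y) = 0 := by
  obtain ⟨f1, f2, f3⟩ := hf
  have h0 := v_E (f2 x) hx
  rw [← h0]
  apply AddValuation.map_eq_of_lt_sub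
  rw [h0]; exact f3 x y h

lemma exists_comb [CompactSpace X] {f g : X → K (Option 𝓑)} (hf : f ∈ A 𝓑) (hg : g ∈ A 𝓑) :
    ∃ m : ℕ, ∀ x, f x + T none ^ m * g x = 0 → f x = 0 ∧ g x = 0 := by
  have hfin := (hf.1.prodMk hg.1).range_finite
  set S := range (fun x => (f x, g x)) with hS
  have hbad : (⋃ z ∈ S, {m : ℕ | z.1 + T none ^ m * z.2 = 0 ∧ z.2 ≠ 0}).Finite := by
    refine hfin.biUnion fun z _ => Set.Subsingleton.finite ?_
    rintro m ⟨hm, h2⟩ n ⟨hn, -⟩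
    apply T_pow_inj (none : Option 𝓑)
    exact mul_right_cancel₀ h2 (add_left_cancel (hm.trans hn.symm))
  obtain ⟨m, hm⟩ := hbad.exists_notMem
  refine ⟨m, fun x hx => ?_⟩
  have h2 : g x = 0 := by
    by_contra h2
    exact hm (mem_iUnion₂.2 ⟨(f x, g x), ⟨x, rfl⟩, hx, h2⟩)
  rw [h2] at hx
  exact ⟨by simpa using hx, h2⟩

lemma exists_comb_finset [CompactSpace X] (J : Ideal (A 𝓑)) (s : Finset (A 𝓑))
    (hs : ∀ f ∈ s, f ∈ J) : ∃ b ∈ J, ∀ x, b.1 x = 0 → ∀ f ∈ s, f.1 x = 0 := by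
  classical
  induction s using Finset.induction_on with
  | empty => exact ⟨0, zero_mem _, by simp⟩
  | insert f s _ ih =>
    obtain ⟨b, hb, h⟩ := ih fun g hg => hs g (Finset.mem_insert_of_mem hg)
    obtain ⟨m, hm⟩ := exists_comb f.2 b.2
    refine ⟨f + ⟨_, t_mem m⟩ * b,
      add_mem (hs f (Finset.mem_insert_self _ _)) (J.mul_mem_left _ hb), fun x hx g hg => ?_⟩
    obtain ⟨h1, h2⟩ := hm x hx
    rcases Finset.mem_insert.1 hg with rfl | hg
    · exact h1
    · exact h x h2 g hg

lemma exists_div [CompactSpace X] (a b : A 𝓑) (hab : ∀ x, b.1 x = 0 → a.1 x = 0) :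
    ∃ (N : ℕ) (c : A 𝓑), a ^ N = c * b := by
  have hM : ∃ M : ℕ, ∀ x y, b.1 y ≠ 0 → v (wt 𝓑 x) (b.1 y) ≤ ((M : ℤ) : WithTop ℤ) := by
    have hfin := b.2.1.range_finite
    have : ∀ z : K (Option 𝓑), ∃ M : ℕ, z ≠ 0 → ∀ w : Option 𝓑 → ℕ, (∀ i, w i ≤ 1) →
        v w z ≤ ((M : ℤ) : WithTop ℤ) := by
      intro z
      by_cases hz : z = 0
      · exact ⟨0, fun h => absurd hz h⟩
      · obtain ⟨M, h⟩ := v_bound z hz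
        exact ⟨M, fun _ => h⟩
    choose M hM using this
    obtain ⟨N, hN⟩ := (hfin.image M).bddAbove
    refine ⟨N, fun x y hy => (hM _ hy _ (wt_le 𝓑 x)).trans ?_⟩
    exact_mod_cast hN ⟨_, ⟨y, rfl⟩, rfl⟩
  obtain ⟨M, hM⟩ := hM
  have hN := (a ^ (M + 1)).2
  obtain ⟨e1, e2, e3⟩ := hN
  obtain ⟨b1, b2, b3⟩ := id b.2
  refine ⟨M + 1, ⟨fun x => (a ^ (M + 1)).1 x / b.1 x, e1.div b1,
    fun x => div_mem (e2 x) (b2 x), fun x y h => ?_⟩, ?_⟩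
  · by_cases hx : b.1 x = 0
    · simp only [hx, div_zero, sub_zero]
      by_cases hy : b.1 y = 0
      · simp [hy]
      have hv := b3 x y h
      have hav : 0 < v (wt 𝓑 x) (a.1 y) := by
        have := a.2.2.2 x y h
        rwa [hab x hx, sub_zero] at this
      have key : v (wt 𝓑 x) ((a ^ (M + 1)).1 y / b.1 y) + v (wt 𝓑 x) (b.1 y)
          = (M + 1) • v (wt 𝓑 x) (a.1 y) := by
        rw [← (v _).map_mul, div_mul_cancel₀ _ hy, ← (v _).map_pow]; rfl
      have hle := hM x y hy
      generalize v (wt 𝓑 x) ((a ^ (M + 1)).1 y / b.1 y) = p at *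
      generalize v (wt 𝓑 x) (b.1 y) = q at *
      generalize v (wt 𝓑 x) (a.1 y) = r at *
      by_contra hp
      rw [not_lt] at hp
      have h1 : (M + 1) • r ≤ ((M : ℤ) : WithTop ℤ) := by
        rw [← key]; simpa using add_le_add hp hle
      cases r with
      | top => 
        rw [succ_nsmul] at h1
        simp at h1
      | coe r =>
        have h2 : (M + 1) • r ≤ (M : ℤ) := by exact_mod_cast h1
        have h3 : 0 < r := by exact_mod_cast hav
        rw [nsmul_eq_mul] at h2
        push_cast at h2
        nlinarith
    · have hy := gen_ne b.2 h hx
      have hx' := v_E (b2 x) hx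
      have hy0 : b.1 y ≠ 0 := by
        intro h0; rw [h0] at hy; simp at hy
      have key : ((a ^ (M + 1)).1 y / b.1 y - (a ^ (M + 1)).1 x / b.1 x) * (b.1 y * b.1 x)
          = ((a ^ (M + 1)).1 y - (a ^ (M + 1)).1 x) * b.1 x
            - (a ^ (M + 1)).1 x * (b.1 y - b.1 x) := by
        field_simp; ring
      have := congrArg (v (wt 𝓑 x)) key
      rw [(v _).map_mul, (v _).map_mul (b.1 y), hy, hx', add_zero, add_zero] at this
      rw [this, sub_eq_add_neg]
      refine (v _).map_lt_add ?_ ?_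
      · rw [(v _).map_mul, hx', add_zero]; exact e3 x y h
      · rw [(v _).map_neg, (v _).map_mul]
        rw [add_comm]; exact add_pos_of_pos_of_nonneg (b3 x y h) (v_E_nonneg (e2 x))
  · ext x
    change (a ^ (M + 1)).1 x = (a ^ (M + 1)).1 x / b.1 x * b.1 x
    by_cases hx : b.1 x = 0
    · have : (a ^ (M + 1)).1 x = 0 := by
        change a.1 x ^ (M + 1) = 0
        rw [hab x hx]; simp
      rw [this]; simp
    · rw [div_mul_cancel₀ _ hx]

/-- The prime attached to a point. -/
def pt (𝓑 : Set (Set X)) (x : X) : PrimeSpectrum (A 𝓑) :=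
  ⟨RingHom.ker ((Pi.evalRingHom (fun _ : X => K (Option 𝓑)) x).comp (A 𝓑).subtype),
    RingHom.ker_isPrime _⟩

lemma mem_pt {x : X} {f : A 𝓑} : f ∈ (pt 𝓑 x).asIdeal ↔ f.1 x = 0 := Iff.rfl

lemma pt_surjective [CompactSpace X] : Function.Surjective (pt 𝓑) := by
  classical
  intro Q
  by_contra hQ
  push Not at hQ
  have hne : ∀ x, ∃ f : A 𝓑, ¬ (f.1 x = 0 ↔ f ∈ Q.asIdeal) := by
    intro x
    by_contra! h
    exact hQ x (PrimeSpectrum.ext (Ideal.ext fun f => mem_pt.trans (h f)))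
  choose F hF using hne
  obtain ⟨s, hs⟩ := isCompact_univ.elim_nhds_subcover (fun x => {y | (F x).1 y = (F x).1 x})
    (fun x _ => (F x).2.1.eventually_eq x)
  obtain ⟨b, hbQ, hb⟩ := exists_comb_finset Q.asIdeal ((s.image F).filter (· ∈ Q.asIdeal))
    (fun f hf => (Finset.mem_filter.1 hf).2)
  set a : A 𝓑 := ∏ f ∈ (s.image F).filter (· ∉ Q.asIdeal), f with ha
  have haQ : a ∉ Q.asIdeal := by
    intro h
    obtain ⟨f, hf, hfQ⟩ := (Ideal.IsPrime.prod_mem_iff (hp := Q.2)).1 h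
    exact (Finset.mem_filter.1 hf).2 hfQ
  obtain ⟨N, c, hc⟩ := exists_div a b (by
    intro y hy
    obtain ⟨x, hxs, hx⟩ := mem_iUnion₂.1 (hs.2 (mem_univ y))
    have hx' : (F x).1 y = (F x).1 x := hx
    by_cases hFQ : F x ∈ Q.asIdeal
    · exfalso
      apply hF x
      have := hb y hy (F x) (Finset.mem_filter.2 ⟨Finset.mem_image_of_mem _ hxs, hFQ⟩)
      rw [hx'] at this
      simp [this, hFQ]
    · have h0 : (F x).1 y = 0 := by
        rw [hx']
        have := hF x
        by_contra h
        exact this ⟨fun h' => absurd h' h, fun h' => absurd h' hFQ⟩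
      rw [← mem_pt (𝓑 := 𝓑)] at h0 ⊢
      exact (Ideal.IsPrime.prod_mem_iff (hp := (pt 𝓑 y).2)).2
        ⟨F x, Finset.mem_filter.2 ⟨Finset.mem_image_of_mem _ hxs, hFQ⟩, h0⟩)
  apply haQ
  apply Q.2.mem_of_pow_mem N
  rw [hc]
  exact Q.asIdeal.mul_mem_left c hbQ

end

/-- Hochster's theorem, in the form needed. -/
theorem main {X : Type u} (𝒯 : TopologicalSpace X) (𝓑 : Set (Set X))
    (h𝓑 : @TopologicalSpace.IsTopologicalBasis X 𝒯 𝓑) (h0 : @T0Space X 𝒯)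
    (t : TopologicalSpace X) (hc : @CompactSpace X t) (hcl : ∀ B ∈ 𝓑, @IsClopen X t B) :
    ∃ (R : Type u) (_ : CommRing R),
      Nonempty (@Homeomorph X (PrimeSpectrum R) 𝒯 PrimeSpectrum.zariskiTopology) := by
  classical
  refine ⟨@A X t 𝓑, inferInstance, ?_⟩
  have hopen : ∀ f : @A X t 𝓑, @IsOpen X 𝒯 {x | f.1 x ≠ 0} := by
    intro f
    rw [@TopologicalSpace.IsTopologicalBasis.isOpen_iff X 𝒯 _ _ h𝓑]
    intro x hx
    have hC : @IsCompact X t {y | f.1 y = 0} :=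
      (f.2.1.isClosed_fiber 0).isCompact
    have hsep : ∀ z ∈ {y | f.1 y = 0}, ∃ B ∈ 𝓑, x ∈ B ∧ z ∉ B := by
      intro z hz
      by_contra! h
      have := @gen_ne X t 𝓑 f.1 f.2 x z (fun B hB hxB => h B hB hxB) hx
      have hz' : f.1 z = 0 := hz
      rw [hz'] at this
      simp at this
    choose! B hB hxB hzB using hsep
    obtain ⟨s, hs, hcov⟩ := @IsCompact.elim_nhds_subcover X t _ hC (fun z => (B z)ᶜ)
      (fun z hz => (hcl _ (hB z hz)).compl.isOpen.mem_nhds (hzB z hz))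
    have hO : @IsOpen X 𝒯 (⋂ z ∈ s, B z) :=
      @isOpen_biInter_finset _ X 𝒯 s _ fun z hz =>
        @TopologicalSpace.IsTopologicalBasis.isOpen X 𝒯 _ _ h𝓑 (hB z (hs z hz))
    obtain ⟨B', hB', hx', hsub⟩ := (@TopologicalSpace.IsTopologicalBasis.isOpen_iff X 𝒯 _ _ h𝓑).1
      hO x (mem_iInter₂.2 fun z hz => hxB z (hs z hz))
    refine ⟨B', hB', hx', fun y hy hy0 => ?_⟩
    obtain ⟨z, hz, hzy⟩ := mem_iUnion₂.1 (hcov hy0)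
    exact hzy (mem_iInter₂.1 (hsub hy) z hz)
  have hsurj : Function.Surjective (@pt X t 𝓑) := @pt_surjective X t 𝓑 hc
  have hind : @Topology.IsInducing X _ 𝒯 _ (@pt X t 𝓑) := by
    refine @Topology.IsInducing.mk X _ 𝒯 _ _ (le_antisymm ?_ ?_)
    · rw [← continuous_iff_le_induced]
      refine (@TopologicalSpace.IsTopologicalBasis.continuous_iff _ _ 𝒯 _ _
        PrimeSpectrum.isTopologicalBasis_basic_opens _).2 ?_
      rintro _ ⟨f, rfl⟩
      exact hopen f
    · rw [@TopologicalSpace.IsTopologicalBasis.eq_generateFrom X 𝒯 _ h𝓑]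
      refine le_generateFrom fun B hB => ?_
      refine ⟨PrimeSpectrum.basicOpen (R := @A X t 𝓑) ⟨_, @ind_mem X t 𝓑 ⟨B, hB⟩ (hcl B hB)⟩,
        PrimeSpectrum.isOpen_basicOpen, ?_⟩
      ext x
      change ¬ ((if x ∈ B then T (some ⟨B, hB⟩) else 0 : K (Option 𝓑)) = 0) ↔ x ∈ B
      by_cases hx : x ∈ B <;> simp [hx, T_ne]
  exact ⟨@Equiv.toHomeomorphOfIsInducing X _ 𝒯 _
    (Equiv.ofBijective _ ⟨@Topology.IsInducing.injective X _ 𝒯 _ h0 _ hind, hsurj⟩) hind⟩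

end Hoch

/-- Let `(X, 𝒯)` be a topological space and `𝓑` a basis of open sets of `X`, and let `u`
denote the `𝓑`-ultrafilter topology on `X`.  Then: (1) `u` is finer than or equal to `𝒯`;
(2) if `(X, 𝒯)` is T₀ then `u` is Hausdorff and totally disconnected; (3) if `(X, 𝒯)` is T₀
and `u` is compact, then `u` is the coarsest topology in which every member of `𝓑` is clopen,
and `(X, 𝒯)` is a spectral space.  (In Mathlib's order on topologies, `u ≤ 𝒯` means that `u`
is finer than or equal to `𝒯`.) -/
theorem stmt14 {X : Type u} (𝒯 : TopologicalSpace X) (𝓑 : Set (Set X))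
    (h𝓑 : @TopologicalSpace.IsTopologicalBasis X 𝒯 𝓑)
    (u : TopologicalSpace X)
    (hu : ∀ C : Set X, @IsClosed X u C ↔ UStable 𝓑 C) :
    u ≤ 𝒯 ∧
    (@T0Space X 𝒯 → @T2Space X u ∧ @TotallyDisconnectedSpace X u) ∧
    (@T0Space X 𝒯 → @CompactSpace X u →
      ((∀ B ∈ 𝓑, @IsClopen X u B) ∧
        ∀ t' : TopologicalSpace X, (∀ B ∈ 𝓑, @IsClopen X t' B) → t' ≤ u) ∧
      IsSpectral 𝒯) := by
  have hcl : ∀ B ∈ 𝓑, @IsClopen X u B := by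
    intro B hB
    refine ⟨(hu B).2 fun 𝒰 x hx => ?_, ?_⟩
    · refine (hx B hB).2 ?_
      have : (Subtype.val ⁻¹' B : Set B) = univ := by ext z; simp
      rw [this]; exact Filter.univ_mem
    · rw [← @isClosed_compl_iff X u]
      refine (hu _).2 fun 𝒰 x hx hxB => ?_
      have h1 := (hx B hB).1 hxB
      have : (Subtype.val ⁻¹' B : Set (Bᶜ : Set X)) = ∅ := by
        ext z; simpa using z.2
      rw [this] at h1
      exact 𝒰.empty_notMem h1
  have hsep : @T0Space X 𝒯 → ∀ x y : X, x ≠ y → ∃ U, @IsClopen X u U ∧ x ∈ U ∧ y ∈ Uᶜ := by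
    intro h0 x y hxy
    obtain ⟨U, hU, h⟩ := @exists_isOpen_xor_mem X 𝒯 h0 x y hxy
    rcases h with ⟨h1, h2⟩ | ⟨h1, h2⟩
    · obtain ⟨B, hB, hx, hs⟩ :=
        (@TopologicalSpace.IsTopologicalBasis.isOpen_iff X 𝒯 _ _ h𝓑).1 hU x h1
      exact ⟨B, hcl B hB, hx, fun h => h2 (hs h)⟩
    · obtain ⟨B, hB, hx, hs⟩ :=
        (@TopologicalSpace.IsTopologicalBasis.isOpen_iff X 𝒯 _ _ h𝓑).1 hU y h1
      exact ⟨Bᶜ, (hcl B hB).compl, fun h => h2 (hs h), fun h => h hx⟩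
  refine ⟨?_, fun h0 => ?_, fun h0 hc => ⟨⟨hcl, fun t' ht' => ?_⟩, ?_⟩⟩
  · rw [@TopologicalSpace.IsTopologicalBasis.eq_generateFrom X 𝒯 _ h𝓑]
    exact le_generateFrom fun B hB => (hcl B hB).isOpen
  · have : @TotallySeparatedSpace X u := by
      letI := u
      rw [totallySeparatedSpace_iff_exists_isClopen]
      intro x y hxy
      exact hsep h0 x y hxy
    exact ⟨@TotallySeparatedSpace.t2Space X u this,
      @TotallySeparatedSpace.totallyDisconnectedSpace X u this⟩
  · intro U hU
    rw [← compl_compl U, @isOpen_compl_iff X _ t']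
    have hst := (hu _).1 ((@isClosed_compl_iff X u U).2 hU)
    letI := t'
    rw [isClosed_iff_ultrafilter]
    intro x 𝒰 hle hmem
    have hr : range (Subtype.val : (Uᶜ : Set X) → X) ∈ 𝒰 := by
      rw [Subtype.range_val]; exact hmem
    refine hst (𝒰.comap Subtype.val_injective hr) (a := x) ?_
    intro B hB
    have hB' : Subtype.val ⁻¹' B ∈ 𝒰.comap Subtype.val_injective hr ↔ B ∈ 𝒰 := by
      rw [Ultrafilter.mem_comap, Subtype.image_preimage_coe, inter_comm]
      exact ⟨fun h => Filter.mem_of_superset h inter_subset_left,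
        fun h => Filter.inter_mem h hmem⟩
    rw [hB']
    constructor
    · intro hx
      exact hle ((ht' B hB).isOpen.mem_nhds hx)
    · intro hBU
      by_contra hx
      exact Ultrafilter.compl_mem_iff_notMem.1
        (hle ((ht' B hB).compl.isOpen.mem_nhds hx)) hBU
  · exact Hoch.main 𝒯 𝓑 h𝓑 h0 u hc hcl
end

section
/- Let X be a topological space. The following are equivalent: (i) X is a spectral space; (ii) there is a basis 𝓑 of X such that X with the 𝓑-ultrafilter topology is compact and Hausdorff; (iii) X is T₀ and there is a basis 𝓑 of X such that X_𝓑(𝒰) ≠ ∅ for every ultrafilter 𝒰 on X; (iv) X is T₀ and there is a subbasis 𝓢 of X such that X_𝓢(𝒰) ≠ ∅ for every ultrafilter 𝒰 on X. -/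
open Set

universe u

/-- The ultrafilter limit set `X_𝓕(𝒰)` for an ultrafilter `𝒰` on the whole set `X`
(note that `F ∩ X = F`). -/
def uLimTop {X : Type*} (𝓕 : Set (Set X)) (𝒰 : Ultrafilter X) : Set X :=
  {x : X | ∀ F ∈ 𝓕, x ∈ F ↔ F ∈ 𝒰}

section Vals
open Polynomial WithZero
open scoped WithZero

lemma lt_one_le_exp {x : ℤᵐ⁰} (h : x < 1) : x ≤ exp (-1 : ℤ) := by
  rcases eq_or_ne x 0 with rfl | hx
  · simp
  · rw [← WithZero.exp_log hx, ← WithZero.exp_zero] at h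
    rw [← WithZero.exp_log hx]
    rw [WithZero.exp_lt_exp] at h
    rw [WithZero.exp_le_exp]
    omega

noncomputable def subHom (σ : Type u) (y : Set σ) :
    MvPolynomial σ ℚ →+* Polynomial (FractionRing (MvPolynomial σ ℚ)) := by
  classical
  exact (MvPolynomial.aeval (fun s => if s ∈ y then
    C (algebraMap (MvPolynomial σ ℚ) (FractionRing (MvPolynomial σ ℚ)) (MvPolynomial.X s)) else
    C (algebraMap (MvPolynomial σ ℚ) (FractionRing (MvPolynomial σ ℚ)) (MvPolynomial.X s)) * X)
    : MvPolynomial σ ℚ →ₐ[ℚ] Polynomial (FractionRing (MvPolynomial σ ℚ))).toRingHom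

lemma subHom_X_mem {σ : Type u} {y : Set σ} {s : σ} (h : s ∈ y) :
    subHom σ y (MvPolynomial.X s) =
    C (algebraMap (MvPolynomial σ ℚ) (FractionRing (MvPolynomial σ ℚ)) (MvPolynomial.X s)) := by
  simp [subHom, h]

lemma subHom_X_not_mem {σ : Type u} {y : Set σ} {s : σ} (h : s ∉ y) :
    subHom σ y (MvPolynomial.X s) =
    C (algebraMap (MvPolynomial σ ℚ) (FractionRing (MvPolynomial σ ℚ)) (MvPolynomial.X s)) * X := by
  simp [subHom, h]

lemma subHom_eval {σ : Type u} (y : Set σ) (p : MvPolynomial σ ℚ) :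
    (subHom σ y p).eval 1 = algebraMap (MvPolynomial σ ℚ) (FractionRing (MvPolynomial σ ℚ)) p := by
  have : (Polynomial.evalRingHom (1 : FractionRing (MvPolynomial σ ℚ))).comp (subHom σ y) =
      algebraMap (MvPolynomial σ ℚ) (FractionRing (MvPolynomial σ ℚ)) := by
    apply MvPolynomial.ringHom_ext
    · intro r
      exact congrFun (congrArg DFunLike.coe (RingHom.ext_rat
        (((Polynomial.evalRingHom (1 : FractionRing (MvPolynomial σ ℚ))).comp (subHom σ y)).comp
          MvPolynomial.C) ((algebraMap (MvPolynomial σ ℚ) (FractionRing (MvPolynomial σ ℚ))).comp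
          MvPolynomial.C))) r
    · intro s
      by_cases h : s ∈ y
      · simp [subHom_X_mem h]
      · simp [subHom_X_not_mem h]
  exact congrFun (congrArg DFunLike.coe this) p

lemma subHom_inj {σ : Type u} (y : Set σ) : Function.Injective (subHom σ y) := by
  intro p q h
  apply IsFractionRing.injective (MvPolynomial σ ℚ) (FractionRing (MvPolynomial σ ℚ))
  rw [← subHom_eval y, h, subHom_eval]

lemma subHom_deg {σ : Type u} (p : MvPolynomial σ ℚ) :
    ∃ N : ℕ, ∀ y, (subHom σ y p).natDegree ≤ N := by
  induction p using MvPolynomial.induction_on with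
  | C a =>
    refine ⟨0, fun y => ?_⟩
    simp [subHom]
  | add p q hp hq =>
    obtain ⟨N, hN⟩ := hp
    obtain ⟨M, hM⟩ := hq
    refine ⟨max N M, fun y => ?_⟩
    rw [map_add]
    exact (natDegree_add_le _ _).trans (max_le_max (hN y) (hM y))
  | mul_X p s hp =>
    obtain ⟨N, hN⟩ := hp
    refine ⟨N + 1, fun y => ?_⟩
    rw [map_mul]
    refine natDegree_mul_le.trans (add_le_add (hN y) ?_)
    by_cases h : s ∈ y
    · simp [subHom_X_mem h]
    · rw [subHom_X_not_mem h]
      exact (natDegree_C_mul_le _ _).trans natDegree_X_le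

lemma exists_vals (σ : Type u) : ∃ (K : Type u) (_ : Field K) (_ : CharZero K) (T : σ → K)
    (v : Set σ → Valuation K ℤᵐ⁰) (F : Set σ → Subfield K),
    (∀ y f, f ∈ F y → f ≠ 0 → v y f = 1) ∧ (∀ y s, s ∈ y → T s ∈ F y) ∧ (∀ s, T s ≠ 0) ∧
    (∀ y s, s ∉ y → v y (T s) < 1) ∧ ∀ b, b ≠ 0 → ∃ N : ℕ, ∀ y, exp (-(N : ℤ)) ≤ v y b := by
  let R := MvPolynomial σ ℚ
  let K := FractionRing R
  have inj : ∀ y, Function.Injective ((algebraMap K[X] (RatFunc K)).comp (subHom σ y)) :=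
    fun y => (IsFractionRing.injective K[X] (RatFunc K)).comp (subHom_inj y)
  let ψ : Set σ → (K →+* RatFunc K) := fun y => IsFractionRing.lift (inj y)
  have hψ : ∀ y (p : R), ψ y (algebraMap R K p) = algebraMap K[X] (RatFunc K) (subHom σ y p) :=
    fun y p => IsFractionRing.lift_algebraMap (inj y) p
  let w : Valuation (RatFunc K) ℤᵐ⁰ := (idealX K).valuation (RatFunc K)
  have hw1 : ∀ p : K[X], w (algebraMap K[X] (RatFunc K) p) ≤ 1 := fun p =>
    (idealX K).valuation_le_one p
  have hX : w (algebraMap K[X] (RatFunc K) X) < 1 := by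
    have := valuation_X_eq_neg_one K
    rw [RatFunc.algebraMap_X]
    change (idealX K).valuation (RatFunc K) _ < 1
    rw [this, ← WithZero.exp_zero, WithZero.exp_lt_exp]
    norm_num
  refine ⟨K, inferInstance, inferInstance, fun s => algebraMap R K (MvPolynomial.X s),
    fun y => w.comap (ψ y),
    fun y => (ψ y).eqLocusField ((algebraMap K[X] (RatFunc K)).comp C), ?_, ?_, ?_, ?_, ?_⟩
  · intro y f hf hf0
    rw [RingHom.mem_eqLocusField] at hf
    rw [Valuation.comap_apply, hf]
    apply le_antisymm (hw1 _)
    have h2 := hw1 (C f⁻¹)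
    have : w (algebraMap K[X] (RatFunc K) (C f)) * w (algebraMap K[X] (RatFunc K) (C f⁻¹)) = 1 := by
      rw [← map_mul, ← map_mul, ← C_mul, mul_inv_cancel₀ hf0]; simp
    rw [← this]
    exact mul_le_of_le_one_right' h2
  · intro y s hs
    rw [RingHom.mem_eqLocusField, hψ, subHom_X_mem hs]; rfl
  · intro s
    rw [Ne, map_eq_zero_iff _ (IsFractionRing.injective R K)]
    exact MvPolynomial.X_ne_zero s
  · intro y s hs
    rw [Valuation.comap_apply, hψ, subHom_X_not_mem hs, map_mul, map_mul]
    exact (mul_le_of_le_one_left' (hw1 _)).trans_lt hX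
  · intro b hb
    obtain ⟨p, q, hq, rfl⟩ := IsFractionRing.div_surjective (A := R) b
    have hp : p ≠ 0 := by rintro rfl; simp at hb
    obtain ⟨N, hN⟩ := subHom_deg p
    refine ⟨N + 1, fun y => ?_⟩
    rw [Valuation.comap_apply, map_div₀, map_div₀, hψ, hψ]
    have hp' : subHom σ y p ≠ 0 := by
      rw [Ne, map_eq_zero_iff _ (subHom_inj y)]; exact hp
    have h1 : exp (-((N + 1 : ℕ) : ℤ)) ≤ w (algebraMap K[X] (RatFunc K) (subHom σ y p)) := by
      by_contra hcon
      push Not at hcon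
      have h3 : (idealX K).intValuation (subHom σ y p) ≤ exp (-((N + 1 : ℕ) : ℤ)) := by
        rw [← (idealX K).valuation_of_algebraMap (K := RatFunc K)]; exact hcon.le
      rw [(idealX K).intValuation_le_pow_iff_mem, idealX_span, Ideal.span_singleton_pow,
        Ideal.mem_span_singleton] at h3
      have := Polynomial.natDegree_le_of_dvd h3 hp'
      rw [natDegree_X_pow] at this
      have := hN y
      omega
    refine h1.trans ?_
    have h2 := hw1 (subHom σ y q)
    rw [le_div_iff₀]
    · exact mul_le_of_le_one_right' h2
    · rw [Valuation.pos_iff, Ne, map_eq_zero_iff _ (IsFractionRing.injective K[X] (RatFunc K)),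
        map_eq_zero_iff _ (subHom_inj y)]
      exact nonZeroDivisors.ne_zero hq
end Vals

section Hoch
open WithZero TopologicalSpace
open scoped WithZero

lemma isSpectral_generateFrom {X : Type u} [TopologicalSpace X] [CompactSpace X] (S : Set (Set X))
    (hS : ∀ s ∈ S, IsClopen s) (hsep : ∀ x y, (∀ s ∈ S, x ∈ s ↔ y ∈ s) → x = y) :
    IsSpectral (generateFrom S) := by
  classical
  obtain ⟨K, _, _, T, v, F, hF, hTF, hT0, hTv, hN⟩ := exists_vals.{u} S
  let g : X → Set S := fun x => {s | x ∈ s.1}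
  have hF1 : ∀ y f, f ∈ F y → v y f ≤ 1 := by
    intro y f hf
    by_cases h : f = 0
    · simp [h]
    · exact (hF y f hf h).le
  have hval : ∀ y a b, b ∈ F y → v y (a - b) < 1 → v y a ≤ 1 := by
    intro y a b hb h
    have : a = (a - b) + b := by ring
    rw [this]
    exact (v y).map_add_le h.le (hF1 y b hb)
  let A : Subring (LocallyConstant X K) :=
    { carrier := {f | (∀ x, f x ∈ F (g x)) ∧ ∀ x y, g y ⊆ g x → v (g y) (f x - f y) < 1}
      mul_mem' := by
        rintro a b ⟨ha, ha'⟩ ⟨hb, hb'⟩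
        refine ⟨fun x => mul_mem (ha x) (hb x), fun x y h => ?_⟩
        have e : (a * b) x - (a * b) y = a x * (b x - b y) + (a x - a y) * b y := by
          simp only [LocallyConstant.mul_apply]; ring
        rw [e]
        apply (v (g y)).map_add_lt
        · rw [map_mul]
          exact (mul_le_of_le_one_left' (hval _ _ _ (ha y) (ha' x y h))).trans_lt (hb' x y h)
        · rw [map_mul]
          exact (mul_le_of_le_one_right' (hF1 _ _ (hb y))).trans_lt (ha' x y h)
      one_mem' := ⟨fun x => one_mem _, fun x y h => by simp⟩
      add_mem' := by
        rintro a b ⟨ha, ha'⟩ ⟨hb, hb'⟩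
        refine ⟨fun x => add_mem (ha x) (hb x), fun x y h => ?_⟩
        have e : (a + b) x - (a + b) y = (a x - a y) + (b x - b y) := by
          simp only [LocallyConstant.add_apply]; ring
        rw [e]
        exact (v (g y)).map_add_lt (ha' x y h) (hb' x y h)
      zero_mem' := ⟨fun x => zero_mem _, fun x y h => by simp⟩
      neg_mem' := by
        rintro a ⟨ha, ha'⟩
        refine ⟨fun x => neg_mem (ha x), fun x y h => ?_⟩
        have e : (-a) x - (-a) y = -(a x - a y) := by
          simp only [LocallyConstant.neg_apply]; ring
        rw [e, Valuation.map_neg]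
        exact ha' x y h }
  have hgen : ∀ (f : A) x y, g y ⊆ g x → f.1 y ≠ 0 → f.1 x ≠ 0 := by
    intro f x y h hy hx
    have h1 := f.2.2 x y h
    rw [hx, zero_sub, Valuation.map_neg, hF _ _ (f.2.1 y) hy] at h1
    exact lt_irrefl _ h1
  have hclopen : ∀ f : A, IsClopen {x | f.1 x ≠ 0} := fun f =>
    f.1.isLocallyConstant.isClopen_fiber 0 |>.compl
  -- supports are open
  have hopen : ∀ f : A, @IsOpen X (generateFrom S) {x | f.1 x ≠ 0} := by
    intro f
    rw [@isOpen_iff_mem_nhds X (generateFrom S)]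
    intro y hy
    have hy : f.1 y ≠ 0 := hy
    by_contra hcon
    have key : (univ ∩ ⋂ i : Option (g y), (match i with
        | none => {x | f.1 x ≠ 0}ᶜ
        | some s => s.1.1 : Set X)).Nonempty := by
      apply isCompact_univ.inter_iInter_nonempty
      · rintro (_ | s)
        · exact (hclopen f).compl.isClosed
        · exact (hS _ s.1.2).isClosed
      · intro t
        rw [univ_inter]
        by_contra hem
        apply hcon
        have : (⋂ s ∈ t.eraseNone, (s.1.1 : Set X)) ∈ @nhds _ (generateFrom S) y := by
          rw [Filter.biInter_finset_mem]
          intro s _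
          exact @IsOpen.mem_nhds X (generateFrom S) _ _
            (isOpen_generateFrom_of_mem s.1.2) s.2
        filter_upwards [this] with x hx
        by_contra hfx
        apply hem
        refine ⟨x, ?_⟩
        simp only [mem_iInter] at hx ⊢
        rintro (_ | s) hs
        · exact fun hne => hne hfx
        · exact hx s (by simpa using hs)
    obtain ⟨x, -, hx⟩ := key
    rw [mem_iInter] at hx
    exact hx none (hgen f x y (fun s hs => hx (some ⟨s, hs⟩)) hy)
  -- key division property
  have hdiv : ∀ a b : A, (∀ x, b.1 x = 0 → a.1 x = 0) → ∃ (n : ℕ) (c : A), a ^ n = b * c := by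
    intro a b hab
    obtain ⟨N, hNb⟩ : ∃ N : ℕ, ∀ x y, b.1 x ≠ 0 → exp (-(N : ℤ)) ≤ v y (b.1 x) := by
      choose! M hM using hN
      obtain ⟨N, hN'⟩ := (b.1.range_finite.image M).bddAbove
      refine ⟨N, fun x y hx => le_trans ?_ (hM _ hx y)⟩
      rw [WithZero.exp_le_exp]
      have := hN' ⟨_, ⟨x, rfl⟩, rfl⟩
      omega
    have hlc : IsLocallyConstant (fun x => a.1 x ^ (N + 1) / b.1 x) :=
      (a.1.isLocallyConstant.comp (fun z => z ^ (N + 1))).div b.1.isLocallyConstant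
    have hmem : (⟨_, hlc⟩ : LocallyConstant X K) ∈ A := by
      refine ⟨fun x => div_mem (pow_mem (a.2.1 x) _) (b.2.1 x), fun x y h => ?_⟩
      change v (g y) (a.1 x ^ (N + 1) / b.1 x - a.1 y ^ (N + 1) / b.1 y) < 1
      by_cases hy : b.1 y = 0
      · rw [hab y hy, hy]
        simp only [div_zero, sub_zero]
        by_cases hx : b.1 x = 0
        · simp [hx]
        · have h1 := a.2.2 x y h
          rw [hab y hy, sub_zero] at h1
          have h2 := lt_one_le_exp h1
          rw [map_div₀, map_pow, div_lt_one₀ (by rwa [Valuation.pos_iff])]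
          refine lt_of_lt_of_le ?_ (hNb x (g y) hx)
          refine (pow_le_pow_left' h2 _).trans_lt ?_
          rw [← WithZero.exp_nsmul, WithZero.exp_lt_exp]
          simp
      · have hx := hgen b x y h hy
        have vy : v (g y) (b.1 y) = 1 := hF _ _ (b.2.1 y) hy
        have hb := b.2.2 x y h
        have ha := (a ^ (N + 1)).2.2 x y h
        have hay := (a ^ (N + 1)).2.1 y
        have e1 : ∀ z, (a ^ (N + 1)).1 z = a.1 z ^ (N + 1) := fun z => map_pow (LocallyConstant.evalRingHom z) a.1 (N + 1)
        rw [e1, e1] at ha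
        rw [e1] at hay
        have vx : v (g y) (b.1 x) = 1 := by
          rw [← vy]
          apply Valuation.map_eq_of_sub_lt
          rw [vy]; exact hb
        have e : a.1 x ^ (N + 1) / b.1 x - a.1 y ^ (N + 1) / b.1 y =
            ((a.1 x ^ (N + 1) - a.1 y ^ (N + 1)) * b.1 y +
              a.1 y ^ (N + 1) * -(b.1 x - b.1 y)) / (b.1 x * b.1 y) := by
          field_simp
          ring
        rw [e, map_div₀, map_mul, vx, vy, mul_one, div_one]
        apply Valuation.map_add_lt
        · rw [map_mul, vy, mul_one]; exact ha
        · rw [map_mul, Valuation.map_neg]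
          exact (mul_le_of_le_one_left' (hF1 _ _ hay)).trans_lt hb
    refine ⟨N + 1, ⟨_, hmem⟩, ?_⟩
    apply Subtype.ext
    ext x
    simp only [Subring.coe_pow, Subring.coe_mul, LocallyConstant.mul_apply, LocallyConstant.coe_mk]
    have e1 : (a.1 ^ (N + 1)) x = a.1 x ^ (N + 1) :=
      map_pow (LocallyConstant.evalRingHom x) a.1 (N + 1)
    rw [e1]
    by_cases hb : b.1 x = 0
    · rw [hb, hab x hb]; simp
    · field_simp
  -- combining two elements
  have hcomb : ∀ (I : Ideal A) (t : Finset A), (∀ b ∈ t, b ∈ I) →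
      ∃ b ∈ I, ∀ x, b.1 x = 0 → ∀ b' ∈ t, b'.1 x = 0 := by
    intro I t
    induction t using Finset.induction_on with
    | empty => intro _; exact ⟨0, I.zero_mem, by simp⟩
    | insert b₁ t _ ih =>
      intro ht
      obtain ⟨b₂, hb₂, h₂⟩ := ih (fun b hb => ht b (Finset.mem_insert_of_mem hb))
      have hb₁ := ht b₁ (Finset.mem_insert_self _ _)
      have hfin : (range (fun x => - b₁.1 x / b₂.1 x)).Finite :=
        ((b₁.1.isLocallyConstant.neg).div b₂.1.isLocallyConstant).range_finite
      obtain ⟨n, hn⟩ : ∃ n : ℕ, (n : K) ∉ range (fun x => - b₁.1 x / b₂.1 x) := by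
        by_contra hcon
        push Not at hcon
        exact (infinite_range_of_injective (Nat.cast_injective (R := K))).mono
          (by rintro _ ⟨n, rfl⟩; exact hcon n) hfin
      refine ⟨b₁ + n * b₂, I.add_mem hb₁ (I.mul_mem_left _ hb₂), fun x hx => ?_⟩
      have hx' : b₁.1 x + n * b₂.1 x = 0 := by
        have : ((n : LocallyConstant X K)) x = (n : K) := rfl
        simpa [this] using hx
      have hb2 : b₂.1 x = 0 := by
        by_contra h0
        apply hn
        refine ⟨x, ?_⟩
        simp only
        rw [div_eq_iff h0]
        linear_combination -hx'
      rw [hb2, mul_zero, add_zero] at hx'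
      intro b' hb'
      rcases Finset.mem_insert.1 hb' with rfl | hb'
      · exact hx'
      · exact h₂ x hb2 b' hb'
  let ev : X → (A →+* K) := fun x =>
    { toFun := fun f => f.1 x
      map_one' := rfl
      map_mul' := fun _ _ => rfl
      map_zero' := rfl
      map_add' := fun _ _ => rfl }
  let φ : X → PrimeSpectrum A := fun x => ⟨RingHom.ker (ev x), RingHom.ker_isPrime _⟩
  have hφ : ∀ x (f : A), f ∈ (φ x).asIdeal ↔ f.1 x = 0 := fun x f => Iff.rfl
  -- the elements T_s
  have hτ : ∀ s : S, ∃ f : A, ∀ x, f.1 x ≠ 0 ↔ x ∈ s.1 := by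
    intro s
    have hlc : IsLocallyConstant (fun x => if x ∈ s.1 then T s else 0) := by
      have := (LocallyConstant.ofIsClopen (hS _ s.2)).isLocallyConstant.comp
        (fun i => if i = 0 then T s else 0)
      convert this using 2 with x
      simp [LocallyConstant.ofIsClopen]
    have hmem : (⟨_, hlc⟩ : LocallyConstant X K) ∈ A := by
      refine ⟨fun x => ?_, fun x y h => ?_⟩
      · change (if x ∈ s.1 then T s else 0) ∈ F (g x)
        split_ifs with hx
        · exact hTF _ _ hx
        · exact zero_mem _
      · change v (g y) ((if x ∈ s.1 then T s else 0) - (if y ∈ s.1 then T s else 0)) < 1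
        by_cases hy : y ∈ s.1
        · have hx : x ∈ s.1 := h (show s ∈ g y from hy)
          simp [hx, hy]
        · by_cases hx : x ∈ s.1
          · simpa [hx, hy] using hTv (g y) s hy
          · simp [hx, hy]
    refine ⟨⟨_, hmem⟩, fun x => ?_⟩
    change (if x ∈ s.1 then T s else 0) ≠ 0 ↔ _
    simp [hT0]
  have hinj : Function.Injective φ := by
    intro x y hxy
    apply hsep
    intro s hs
    obtain ⟨f, hf⟩ := hτ ⟨s, hs⟩
    rw [← hf x, ← hf y, Ne, Ne, ← hφ, ← hφ, hxy]
  have hsurj : Function.Surjective φ := by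
    intro P
    have key : (univ ∩ ⋂ f : A, (if f ∈ P.asIdeal then {x | f.1 x ≠ 0}ᶜ else
        {x | f.1 x ≠ 0})).Nonempty := by
      apply isCompact_univ.inter_iInter_nonempty
      · intro f
        split_ifs
        · exact (hclopen f).compl.isClosed
        · exact (hclopen f).isClosed
      · intro t
        rw [univ_inter]
        obtain ⟨b, hbP, hb⟩ := hcomb P.asIdeal (t.filter (· ∈ P.asIdeal)) (by simp)
        let a : A := ∏ f ∈ t.filter (· ∉ P.asIdeal), f
        have haP : a ∉ P.asIdeal := by
          intro h
          obtain ⟨f, hf, hf'⟩ := (P.isPrime.prod_mem_iff).1 h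
          simp at hf
          exact hf.2 hf'
        have : ¬ ∀ x, b.1 x = 0 → a.1 x = 0 := by
          intro h
          obtain ⟨n, c, hc⟩ := hdiv a b h
          apply haP
          apply P.isPrime.mem_of_pow_mem n
          rw [hc]
          exact P.asIdeal.mul_mem_right _ hbP
        push Not at this
        obtain ⟨x, hbx, hax⟩ := this
        refine ⟨x, ?_⟩
        simp only [mem_iInter]
        intro f hf
        split_ifs with hfP
        · simpa using hb x hbx f (by simp [hf, hfP])
        · intro h0
          apply hax
          have : ev x a = 0 := by
            rw [map_prod]
            exact Finset.prod_eq_zero (i := f) (by simp [hf, hfP]) h0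
          exact this
    obtain ⟨x, -, hx⟩ := key
    rw [mem_iInter] at hx
    refine ⟨x, ?_⟩
    apply PrimeSpectrum.ext
    ext f
    rw [hφ]
    have := hx f
    split_ifs at this with h
    · simpa [h] using this
    · simpa [h] using this
  refine ⟨A, inferInstance, ⟨?_⟩⟩
  letI : TopologicalSpace X := generateFrom S
  have hcont : Continuous φ := by
    rw [PrimeSpectrum.isTopologicalBasis_basic_opens.continuous_iff]
    rintro _ ⟨f, rfl⟩
    exact hopen f
  have hind : Topology.IsInducing φ := by
    constructor
    apply le_antisymm
    · exact hcont.le_induced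
    · apply le_generateFrom
      intro s hs
      obtain ⟨f, hf⟩ := hτ ⟨s, hs⟩
      refine ⟨PrimeSpectrum.basicOpen f, PrimeSpectrum.isOpen_basicOpen, ?_⟩
      ext x
      exact hf x
  exact (Equiv.ofBijective φ ⟨hinj, hsurj⟩).toHomeomorphOfIsInducing hind
end Hoch

section Final
open TopologicalSpace

/-- The patch topology attached to a family of sets. -/
def patchTop {X : Type u} (S : Set (Set X)) : TopologicalSpace X :=
  generateFrom (S ∪ compl '' S)

lemma patch_isClopen {X : Type u} {S : Set (Set X)} {s : Set X} (hs : s ∈ S) :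
    @IsClopen X (patchTop S) s := by
  let _ := patchTop S
  refine ⟨⟨?_⟩, ?_⟩
  · exact isOpen_generateFrom_of_mem (Or.inr ⟨s, hs, rfl⟩)
  · exact isOpen_generateFrom_of_mem (Or.inl hs)

lemma patch_le_nhds {X : Type u} {S : Set (Set X)} (U : Ultrafilter X) (x : X) :
    (U : Filter X) ≤ @nhds X (patchTop S) x ↔ x ∈ uLimTop S U := by
  constructor
  · intro h s hs
    have hc := patch_isClopen hs
    constructor
    · intro hx
      exact h (@IsOpen.mem_nhds X (patchTop S) x s hc.2 hx)
    · intro hU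
      by_contra hx
      have : sᶜ ∈ U := h (@IsOpen.mem_nhds X (patchTop S) x sᶜ
        (@IsClosed.isOpen_compl X (patchTop S) s hc.1) hx)
      exact (Ultrafilter.compl_mem_iff_notMem.1 this) hU
  · intro h
    rw [patchTop, nhds_generateFrom]
    refine le_iInf₂ fun s hs => ?_
    rw [Filter.le_principal_iff]
    obtain ⟨hxs, hs | ⟨s, hs, rfl⟩⟩ := hs
    · exact (h s hs).1 hxs
    · exact Ultrafilter.compl_mem_iff_notMem.2 (fun hU => hxs ((h s hs).2 hU))

lemma patch_compact {X : Type u} {S : Set (Set X)}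
    (h : ∀ U : Ultrafilter X, (uLimTop S U).Nonempty) : @CompactSpace X (patchTop S) := by
  let _ := patchTop S
  refine ⟨isCompact_iff_ultrafilter_le_nhds.2 fun U _ => ?_⟩
  obtain ⟨x, hx⟩ := h U
  exact ⟨x, mem_univ _, (patch_le_nhds U x).2 hx⟩

lemma sep_of_t0 {X : Type u} (t : TopologicalSpace X) (S : Set (Set X)) (ht : t = generateFrom S)
    (h0 : @T0Space X t) (x y : X) (h : ∀ s ∈ S, x ∈ s ↔ y ∈ s) : x = y := by
  subst ht
  let _ := generateFrom S
  apply Inseparable.eq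
  change nhds x = nhds y
  rw [nhds_generateFrom, nhds_generateFrom]
  congr! 3 with s
  simp only [mem_ofPred_eq]
  constructor
  · rintro ⟨a, b⟩; exact ⟨(h s b).1 a, b⟩
  · rintro ⟨a, b⟩; exact ⟨(h s b).2 a, b⟩

lemma patch_t2 {X : Type u} {S : Set (Set X)}
    (h : ∀ x y, (∀ s ∈ S, x ∈ s ↔ y ∈ s) → x = y) : @T2Space X (patchTop S) := by
  let _ := patchTop S
  refine ⟨fun x y hxy => ?_⟩
  have : ∃ s ∈ S, ¬ (x ∈ s ↔ y ∈ s) := by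
    by_contra hcon
    push Not at hcon
    exact hxy (h x y hcon)
  obtain ⟨s, hs, hne⟩ := this
  have hc : IsClopen s := patch_isClopen hs
  by_cases hx : x ∈ s
  · exact ⟨s, sᶜ, hc.2, hc.1.isOpen_compl, hx, fun hy => hne (by simp [hx, hy]), disjoint_compl_right⟩
  · exact ⟨sᶜ, s, hc.1.isOpen_compl, hc.2, hx, by by_contra hy; exact hne (by simp [hx, hy]),
      disjoint_compl_left⟩

lemma patch_isClosed {X : Type u} {S : Set (Set X)} (C : Set X) :
    @IsClosed X (patchTop S) C ↔ UStable S C := by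
  let _ := patchTop S
  rw [isClosed_iff_ultrafilter]
  constructor
  · intro h U x hx
    refine h x (U.map Subtype.val) ((patch_le_nhds _ x).2 hx) ?_
    rw [Ultrafilter.mem_map]
    simp only [Subtype.coe_preimage_self, Submodule.zero_mem, ofPred_true, mem_ofPred_eq]; exact Filter.univ_mem
  · intro h x U hU hC
    have hr : range (Subtype.val : C → X) ∈ U := by simpa using hC
    refine h (U.comap Subtype.val_injective hr) ?_
    intro s hs
    rw [(patch_le_nhds U x).1 hU s hs, Ultrafilter.mem_comap, Subtype.image_preimage_coe]
    constructor
    · intro h; exact Filter.inter_mem hC h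
    · intro h; exact Filter.mem_of_superset h inter_subset_right

lemma spec_lim {A : Type u} [CommRing A] (U : Ultrafilter (PrimeSpectrum A)) :
    ∃ P : PrimeSpectrum A, ∀ f : A, f ∉ P.asIdeal ↔ {Q : PrimeSpectrum A | f ∉ Q.asIdeal} ∈ U := by
  let I : Ideal A :=
    { carrier := {f | {Q : PrimeSpectrum A | f ∈ Q.asIdeal} ∈ U}
      add_mem' := by
        intro a b ha hb
        exact Filter.mem_of_superset (Filter.inter_mem ha hb) fun Q h => Q.asIdeal.add_mem h.1 h.2
      zero_mem' := by simp only [Subtype.coe_preimage_self, Submodule.zero_mem, ofPred_true, mem_ofPred_eq]; exact Filter.univ_mem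
      smul_mem' := by
        intro c a ha
        exact Filter.mem_of_superset ha fun Q h => Q.asIdeal.mul_mem_left c h }
  have hI : ∀ f, f ∈ I ↔ {Q : PrimeSpectrum A | f ∈ Q.asIdeal} ∈ U := fun f => Iff.rfl
  have hp : I.IsPrime := by
    constructor
    · rw [Ideal.ne_top_iff_one, hI]
      intro h
      obtain ⟨Q, hQ⟩ := U.nonempty_of_mem h
      exact Q.isPrime.one_notMem hQ
    · intro a b hab
      rw [hI] at hab
      have : {Q : PrimeSpectrum A | a ∈ Q.asIdeal} ∪ {Q : PrimeSpectrum A | b ∈ Q.asIdeal} ∈ U :=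
        Filter.mem_of_superset hab fun Q h => Q.isPrime.mem_or_mem h
      exact Ultrafilter.union_mem_iff.1 this
  refine ⟨⟨I, hp⟩, fun f => ?_⟩
  change ¬ (f ∈ I) ↔ _
  rw [hI, ← Ultrafilter.compl_mem_iff_notMem]
  rfl

lemma spectral_imp {X : Type u} [𝒯 : TopologicalSpace X] (h : IsSpectral 𝒯) :
    T0Space X ∧ ∃ 𝓑 : Set (Set X), IsTopologicalBasis 𝓑 ∧
         ∀ 𝒰 : Ultrafilter X, (uLimTop 𝓑 𝒰).Nonempty := by
  obtain ⟨A, _, ⟨e⟩⟩ := h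
  refine ⟨e.isEmbedding.t0Space, _,
    PrimeSpectrum.isTopologicalBasis_basic_opens.isInducing e.isInducing, fun U => ?_⟩
  obtain ⟨P, hP⟩ := spec_lim (U.map e)
  refine ⟨e.symm P, ?_⟩
  rintro _ ⟨_, ⟨f, rfl⟩, rfl⟩
  have := hP f
  rw [Ultrafilter.mem_map] at this
  rw [mem_preimage, e.apply_symm_apply]
  exact this

lemma two_imp {X : Type u} (𝒯 : TopologicalSpace X) (𝓑 : Set (Set X))
    (hB : @IsTopologicalBasis X 𝒯 𝓑) (u : TopologicalSpace X)
    (hu : ∀ C : Set X, @IsClosed X u C ↔ UStable 𝓑 C) (hc : @CompactSpace X u)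
    (ht : @T2Space X u) : @T0Space X 𝒯 ∧ ∀ 𝒰 : Ultrafilter X, (uLimTop 𝓑 𝒰).Nonempty := by
  constructor
  · refine @T0Space.mk X 𝒯 fun x y hxy => ?_
    have hcl : UStable 𝓑 {x} := (hu _).1 isClosed_singleton
    have : y ∈ ({x} : Set X) := by
      apply hcl (pure ⟨x, rfl⟩)
      intro s hs
      rw [Ultrafilter.mem_pure]
      exact ((@inseparable_iff_forall_isOpen X 𝒯 x y).1 hxy s
        (@IsTopologicalBasis.isOpen X 𝒯 s 𝓑 hB hs)).symm
    exact this.symm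
  · have h1 : ∀ s ∈ 𝓑, IsClosed s := by
      intro s hs
      rw [hu]
      intro U x hx
      rw [hx s hs]
      simp only [Subtype.coe_preimage_self, Submodule.zero_mem, ofPred_true, mem_ofPred_eq]; exact Filter.univ_mem
    have h2 : ∀ s ∈ 𝓑, IsClosed sᶜ := by
      intro s hs
      rw [hu]
      intro U x hx hxs
      rw [hx s hs] at hxs
      simp at hxs
    intro U
    obtain ⟨x, -, hx⟩ := isCompact_univ.ultrafilter_le_nhds U (by simp)
    refine ⟨x, fun s hs => ⟨fun h => ?_, fun h => ?_⟩⟩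
    · exact hx ((isClosed_compl_iff.1 (h2 s hs)).mem_nhds h)
    · exact (isClosed_iff_ultrafilter.1 (h1 s hs)) x U hx h
end Final

/-- For a topological space `(X, 𝒯)` the following are equivalent: (i) `X` is spectral;
(ii) there is a basis `𝓑` of `X` such that the `𝓑`-ultrafilter topology is compact and
Hausdorff; (iii) `X` is T₀ and there is a basis `𝓑` of `X` with `X_𝓑(𝒰) ≠ ∅` for every
ultrafilter `𝒰` on `X`; (iv) `X` is T₀ and there is a subbasis `𝓢` of `X` with
`X_𝓢(𝒰) ≠ ∅` for every ultrafilter `𝒰` on `X`. -/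
theorem stmt16 {X : Type u} (𝒯 : TopologicalSpace X) :
    List.TFAE
      [IsSpectral 𝒯,
       ∃ 𝓑 : Set (Set X), @TopologicalSpace.IsTopologicalBasis X 𝒯 𝓑 ∧
         ∃ u : TopologicalSpace X, (∀ C : Set X, @IsClosed X u C ↔ UStable 𝓑 C) ∧
           @CompactSpace X u ∧ @T2Space X u,
       @T0Space X 𝒯 ∧ ∃ 𝓑 : Set (Set X), @TopologicalSpace.IsTopologicalBasis X 𝒯 𝓑 ∧
         ∀ 𝒰 : Ultrafilter X, (uLimTop 𝓑 𝒰).Nonempty,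
       @T0Space X 𝒯 ∧ ∃ 𝓢 : Set (Set X), 𝒯 = TopologicalSpace.generateFrom 𝓢 ∧
         ∀ 𝒰 : Ultrafilter X, (uLimTop 𝓢 𝒰).Nonempty] := by
  tfae_have 1 → 3 := fun h => spectral_imp h
  tfae_have 3 → 4 := fun ⟨h0, B, hB, hU⟩ =>
    ⟨h0, B, @TopologicalSpace.IsTopologicalBasis.eq_generateFrom X 𝒯 B hB, hU⟩
  tfae_have 4 → 1 := by
    rintro ⟨h0, S, hS, hU⟩
    have hsep := sep_of_t0 𝒯 S hS h0
    rw [hS]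
    exact @isSpectral_generateFrom X (patchTop S) (patch_compact hU) S
      (fun s hs => patch_isClopen hs) hsep
  tfae_have 3 → 2 := fun ⟨h0, B, hB, hU⟩ => ⟨B, hB, patchTop B, patch_isClosed, patch_compact hU,
    patch_t2 (sep_of_t0 𝒯 B (@TopologicalSpace.IsTopologicalBasis.eq_generateFrom X 𝒯 B hB) h0)⟩
  tfae_have 2 → 3 := fun ⟨B, hB, u, hu, hc, ht⟩ =>
    ⟨(two_imp 𝒯 B hB u hu hc ht).1, B, hB, (two_imp 𝒯 B hB u hu hc ht).2⟩
  tfae_finish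
end

section
/- Let B|A be an extension of commutative rings with identity and let S(B|A) be the set of all subrings C of B with A ⊆ C ⊆ B. For x ∈ B set U_x := {C ∈ S(B|A) : x ∈ C}, and endow S(B|A) with the Zariski topology, for which {U_x : x ∈ B} is a subbasis of open sets. Then: (1) for every subset Y of S(B|A) and every ultrafilter 𝒰 on Y, the set A_𝒰 := {x ∈ B : U_x ∩ Y ∈ 𝒰} belongs to S(B|A) (i.e., it is a subring of B containing A); (2) S(B|A) with the Zariski topology is a spectral space. -/
open Set

universe u v

noncomputable section SpecRing

/-- The field of rational functions in variables indexed by `B`. -/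
abbrev KF (B : Type v) : Type v := FractionRing (MvPolynomial B ℚ)

/-- Fraction field of the power series ring over `KF B`. -/
abbrev LF (B : Type v) : Type v := FractionRing (PowerSeries (KF B))

/-- the variables -/
def xv {B : Type v} (m : B) : KF B := algebraMap (MvPolynomial B ℚ) (KF B) (MvPolynomial.X m)

open Classical in
/-- Scaling the variables outside `C` by `t`, polynomial version. -/
def sigP {B : Type v} (C : Set B) : MvPolynomial B ℚ →+* Polynomial (KF B) :=
  MvPolynomial.eval₂Hom (Polynomial.C.comp (algebraMap ℚ (KF B)))
    (fun m => if m ∈ C then Polynomial.C (xv m) else Polynomial.C (xv m) * Polynomial.X)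

lemma sigP_eval {B : Type v} (C : Set B) (f : MvPolynomial B ℚ) :
    (sigP C f).eval 1 = algebraMap _ (KF B) f := by
  have : (Polynomial.evalRingHom (1 : KF B)).comp (sigP C)
      = algebraMap (MvPolynomial B ℚ) (KF B) := by
    apply MvPolynomial.ringHom_ext
    · intro r
      have : ((Polynomial.evalRingHom (1 : KF B)).comp (sigP C)).comp MvPolynomial.C
          = (algebraMap (MvPolynomial B ℚ) (KF B)).comp MvPolynomial.C := Subsingleton.elim _ _
      exact congrArg (fun φ => φ r) this
    · intro m
      by_cases h : m ∈ C <;> simp [sigP, h, xv]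
  exact congrArg (fun φ => φ f) this

/-- Scaling, with values in the Laurent series field. -/
def sig0 {B : Type v} (C : Set B) : MvPolynomial B ℚ →+* LF B :=
  ((algebraMap (PowerSeries (KF B)) (LF B)).comp Polynomial.coeToPowerSeries.ringHom).comp (sigP C)

lemma sig0_inj {B : Type v} (C : Set B) : Function.Injective (sig0 C) := by
  unfold sig0
  rw [RingHom.coe_comp, RingHom.coe_comp]
  refine ((IsFractionRing.injective _ _).comp ?_).comp ?_
  · intro a b h
    exact Polynomial.coe_injective _ (by simpa using h)
  · intro f g h
    have := sigP_eval C f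
    rw [h, sigP_eval] at this
    exact (IsFractionRing.injective _ (KF B) this).symm

/-- Scaling on rational functions. -/
def sig {B : Type v} (C : Set B) : KF B →+* LF B := IsFractionRing.lift (sig0_inj C)

lemma sig_algebraMap {B : Type v} (C : Set B) (f : MvPolynomial B ℚ) :
    sig C (algebraMap _ (KF B) f) = sig0 C f := IsFractionRing.lift_algebraMap _ _

lemma sig_xv_mem {B : Type v} {C : Set B} {m : B} (h : m ∈ C) :
    sig C (xv m) = algebraMap _ (LF B) (PowerSeries.C (xv m)) := by
  rw [xv, sig_algebraMap]; simp [sig0, sigP, h, xv]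

lemma sig_xv_notMem {B : Type v} {C : Set B} {m : B} (h : m ∉ C) :
    sig C (xv m) = algebraMap _ (LF B) (PowerSeries.C (xv m) * PowerSeries.X) := by
  rw [xv, sig_algebraMap]; simp [sig0, sigP, h, xv]

lemma sig_finite {B : Type v} (x : KF B) : (Set.range fun C : Set B => sig C x).Finite := by
  have key : ∀ f : MvPolynomial B ℚ, (Set.range fun C : Set B => sig0 C f).Finite := by
    intro f
    induction f using MvPolynomial.induction_on with
    | C a =>
      refine (Set.finite_singleton (algebraMap ℚ (LF B) a)).subset ?_
      rintro _ ⟨C, rfl⟩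
      simp only [Set.mem_singleton_iff]
      have : (sig0 C).comp MvPolynomial.C = algebraMap ℚ (LF B) := Subsingleton.elim _ _
      exact congrArg (fun φ => φ a) this
    | add p q hp hq =>
      refine (Set.Finite.image2 (· + ·) hp hq).subset ?_
      rintro _ ⟨C, rfl⟩
      exact ⟨_, ⟨C, rfl⟩, _, ⟨C, rfl⟩, by simp⟩
    | mul_X p m hp =>
      refine (Set.Finite.image2 (· * ·) hp (Set.toFinite
        {algebraMap _ (LF B) (PowerSeries.C (xv m)),
          algebraMap _ (LF B) (PowerSeries.C (xv m) * PowerSeries.X)})).subset ?_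
      rintro _ ⟨C, rfl⟩
      refine ⟨_, ⟨C, rfl⟩, sig C (xv m), ?_, ?_⟩
      · by_cases h : m ∈ C
        · left; exact sig_xv_mem h
        · right; exact sig_xv_notMem h
      · simp [xv, sig_algebraMap]
  obtain ⟨f, g, hg, rfl⟩ := IsFractionRing.div_surjective (A := MvPolynomial B ℚ) x
  refine (Set.Finite.image2 (· / ·) (key f) (key g)).subset ?_
  rintro _ ⟨C, rfl⟩
  exact ⟨_, ⟨C, rfl⟩, _, ⟨C, rfl⟩, by simp only [map_div₀, sig_algebraMap]⟩

/-- `y` specializes to `x` along `C`. -/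
def Lim {B : Type v} (C : Set B) (y x : KF B) : Prop :=
  ∃ p : PowerSeries (KF B), sig C y = algebraMap _ (LF B) p ∧ PowerSeries.constantCoeff p = x

lemma Lim.zero {B : Type v} (C : Set B) : Lim C 0 0 := ⟨0, by simp, by simp⟩
lemma Lim.one {B : Type v} (C : Set B) : Lim C 1 1 := ⟨1, by simp, by simp⟩
lemma Lim.add {B : Type v} {C : Set B} {a b c d : KF B} (h : Lim C a b) (h' : Lim C c d) :
    Lim C (a + c) (b + d) := by
  obtain ⟨p, hp, rfl⟩ := h
  obtain ⟨q, hq, rfl⟩ := h'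
  exact ⟨p + q, by simp [hp, hq], by simp⟩
lemma Lim.mul {B : Type v} {C : Set B} {a b c d : KF B} (h : Lim C a b) (h' : Lim C c d) :
    Lim C (a * c) (b * d) := by
  obtain ⟨p, hp, rfl⟩ := h
  obtain ⟨q, hq, rfl⟩ := h'
  exact ⟨p * q, by simp [hp, hq], by simp⟩
lemma Lim.neg {B : Type v} {C : Set B} {a b : KF B} (h : Lim C a b) :
    Lim C (-a) (-b) := by
  obtain ⟨p, hp, rfl⟩ := h
  exact ⟨-p, by simp [hp], by simp⟩
lemma Lim.pow {B : Type v} {C : Set B} {a b : KF B} (h : Lim C a b) (n : ℕ) :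
    Lim C (a ^ n) (b ^ n) := by
  obtain ⟨p, hp, rfl⟩ := h
  exact ⟨p ^ n, by simp [hp], by simp⟩
lemma Lim.inv {B : Type v} {C : Set B} {a b : KF B} (h : Lim C a b) (hb : b ≠ 0) :
    Lim C (a⁻¹) (b⁻¹) := by
  obtain ⟨p, hp, rfl⟩ := h
  refine ⟨p⁻¹, ?_, by simp⟩
  rw [map_inv₀, hp]
  apply inv_eq_of_mul_eq_one_right
  rw [← map_mul, PowerSeries.mul_inv_cancel _ hb, map_one]
lemma Lim.ne_zero {B : Type v} {C : Set B} {a b : KF B} (h : Lim C a b) (hb : b ≠ 0) : a ≠ 0 := by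
  rintro rfl
  obtain ⟨p, hp, rfl⟩ := h
  rw [map_zero] at hp
  have : p = 0 := IsFractionRing.injective _ (LF B) (by rw [← hp, map_zero])
  simp [this] at hb

lemma xv_ne_zero {B : Type v} (m : B) : xv m ≠ 0 := by
  unfold xv
  rw [Ne, FaithfulSMul.algebraMap_eq_zero_iff]
  exact MvPolynomial.X_ne_zero m

lemma ps_dvd {k : Type*} [Field k] (p : PowerSeries k) (hp : p ≠ 0) :
    ∃ n : ℕ, p ∣ PowerSeries.X ^ n := by
  obtain ⟨n, u, h⟩ := IsDiscreteValuationRing.associated_pow_irreducible hp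
    PowerSeries.X_irreducible
  exact ⟨n, ⟨u, h.symm⟩⟩

/-- bound for the order, uniformly in `C`. -/
lemma exists_bound {B : Type v} (x : KF B) : ∃ N : ℕ, ∀ n ≥ N, x ≠ 0 → ∀ (C : Set B)
    (p : PowerSeries (KF B)), sig C x = algebraMap _ (LF B) p → p ∣ PowerSeries.X ^ n := by
  have h1 : ∀ y : LF B, ∃ N : ℕ, ∀ p : PowerSeries (KF B), y ≠ 0 → y = algebraMap _ (LF B) p →
      p ∣ PowerSeries.X ^ N := by
    intro y
    by_cases h : y ≠ 0 ∧ ∃ p : PowerSeries (KF B), y = algebraMap _ (LF B) p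
    · obtain ⟨h0, p, rfl⟩ := h
      obtain ⟨n, hn⟩ := ps_dvd p (by rintro rfl; simp at h0)
      refine ⟨n, fun q _ hq => ?_⟩
      rwa [← IsFractionRing.injective _ (LF B) hq]
    · exact ⟨0, fun p h0 hp => (h ⟨h0, p, hp⟩).elim⟩
  choose N hN using h1
  obtain ⟨M, hM⟩ := ((sig_finite x).image N).bddAbove
  refine ⟨M, fun n hn hx C p hp => ?_⟩
  refine (hN _ p ?_ hp).trans (pow_dvd_pow _ (le_trans (hM ⟨_, ⟨C, rfl⟩, rfl⟩) hn))
  simpa using hx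

variable {A : Type u} {B : Type v} [CommRing A] [CommRing B] [Algebra A B]

variable (A B) in
/-- The ring whose spectrum is the space of intermediate rings. -/
def Rg : Subring (Subalgebra A B → KF B) where
  carrier := {r | (∀ C D : Subalgebra A B, C ≤ D → Lim (C : Set B) (r D) (r C)) ∧
    ∃ F : Finset B, ∀ D D' : Subalgebra A B, (∀ m ∈ F, m ∈ D ↔ m ∈ D') → r D = r D'}
  zero_mem' := ⟨fun _ _ _ => Lim.zero _, ∅, fun _ _ _ => rfl⟩
  one_mem' := ⟨fun _ _ _ => Lim.one _, ∅, fun _ _ _ => rfl⟩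
  add_mem' := by
    classical
    rintro a b ⟨ha, F, hF⟩ ⟨hb, G, hG⟩
    refine ⟨fun C D h => (ha C D h).add (hb C D h), F ∪ G, fun D D' h => ?_⟩
    simp only [Pi.add_apply]
    rw [hF D D' fun m hm => h m (Finset.mem_union_left _ hm),
      hG D D' fun m hm => h m (Finset.mem_union_right _ hm)]
  mul_mem' := by
    classical
    rintro a b ⟨ha, F, hF⟩ ⟨hb, G, hG⟩
    refine ⟨fun C D h => (ha C D h).mul (hb C D h), F ∪ G, fun D D' h => ?_⟩
    simp only [Pi.mul_apply]
    rw [hF D D' fun m hm => h m (Finset.mem_union_left _ hm),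
      hG D D' fun m hm => h m (Finset.mem_union_right _ hm)]
  neg_mem' := by
    rintro a ⟨ha, F, hF⟩
    refine ⟨fun C D h => (ha C D h).neg, F, fun D D' h => ?_⟩
    simp only [Pi.neg_apply]
    rw [hF D D' h]

lemma Rg_up (r : Rg A B) {C D : Subalgebra A B} (h : C ≤ D) (hr : r.1 C ≠ 0) : r.1 D ≠ 0 :=
  (r.2.1 C D h).ne_zero hr

lemma finite_range_of_dep {γ : Type*} (r : Subalgebra A B → γ) (F : Finset B)
    (hF : ∀ D D' : Subalgebra A B, (∀ m ∈ F, m ∈ D ↔ m ∈ D') → r D = r D') :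
    (Set.range r).Finite := by
  classical
  have : (Set.range fun D : Subalgebra A B => F.filter (· ∈ D)).Finite :=
    (F.powerset.finite_toSet).subset (by rintro _ ⟨D, rfl⟩; exact Finset.mem_coe.2 (Finset.mem_powerset.2 (Finset.filter_subset _ _)))
  have key : ∀ D, ∃ T ∈ (Set.range fun D : Subalgebra A B => F.filter (· ∈ D)),
      T = F.filter (· ∈ D) := fun D => ⟨_, ⟨D, rfl⟩, rfl⟩
  let g : Finset B → γ := fun T =>
    r (if h : ∃ D : Subalgebra A B, F.filter (· ∈ D) = T then h.choose else ⊥)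
  refine (this.image g).subset ?_
  rintro _ ⟨D, rfl⟩
  refine ⟨_, ⟨D, rfl⟩, ?_⟩
  have hex : ∃ D' : Subalgebra A B, F.filter (· ∈ D') = F.filter (· ∈ D) := ⟨D, rfl⟩
  simp only [g]
  rw [dif_pos hex]
  apply hF
  intro m hm
  have := Finset.ext_iff.1 hex.choose_spec m
  simpa [hm] using this

/-- The key divisibility statement. -/
lemma Rg_dvd (r h : Rg A B) (hD : ∀ D, h.1 D ≠ 0 → r.1 D ≠ 0) : ∃ N : ℕ, r ∣ h ^ N := by
  classical
  obtain ⟨hr, F, hF⟩ := r.2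
  obtain ⟨hh, G, hG⟩ := h.2
  choose N hN using fun x : KF B => exists_bound x
  obtain ⟨M, hM⟩ := ((finite_range_of_dep r.1 F hF).image N).bddAbove
  have hb : ∀ D, N (r.1 D) ≤ M := fun D => hM ⟨_, ⟨D, rfl⟩, rfl⟩
  have hs : (fun D => h.1 D ^ (M + 1) * (r.1 D)⁻¹) ∈ Rg A B := by
    refine ⟨fun C D hCD => ?_, F ∪ G, fun D D' e => ?_⟩
    · by_cases h0 : r.1 D = 0
      · have h1 : r.1 C = 0 := by
          by_contra h1
          exact Rg_up r hCD h1 h0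
        simp only [h0, h1, inv_zero, mul_zero]
        exact Lim.zero _
      by_cases h1 : r.1 C = 0
      · have h2 : h.1 C = 0 := by
          by_contra h2
          exact hD C h2 h1
        obtain ⟨p, hp, hp0⟩ := hr C D hCD
        obtain ⟨q, hq, hq0⟩ := hh C D hCD
        obtain ⟨w, hw⟩ := hN _ M (hb D) h0 C p hp
        rw [h2] at hq0
        obtain ⟨q', rfl⟩ := PowerSeries.X_dvd_iff.2 hq0
        refine ⟨PowerSeries.X * q' ^ (M + 1) * w, ?_, by simp [h1]⟩
        have hpne : algebraMap _ (LF B) p ≠ 0 := by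
          rw [← hp]
          simpa using h0
        rw [map_mul, map_inv₀, map_pow, hp, hq, ← div_eq_mul_inv, div_eq_iff hpne, ← map_pow,
          ← map_mul]
        congr 1
        rw [mul_pow, pow_succ, hw]
        ring
      · exact ((hh C D hCD).pow _).mul ((hr C D hCD).inv h1)
    · simp only
      rw [hF D D' fun m hm => e m (Finset.mem_union_left _ hm),
        hG D D' fun m hm => e m (Finset.mem_union_right _ hm)]
  refine ⟨M + 1, ⟨_, hs⟩, ?_⟩
  apply Subtype.ext
  funext D
  change h.1 D ^ (M + 1) = r.1 D * (h.1 D ^ (M + 1) * (r.1 D)⁻¹)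
  by_cases h0 : r.1 D = 0
  · have h2 : h.1 D = 0 := by
      by_contra h2
      exact hD D h2 h0
    simp [h0, h2]
  · field_simp

lemma Rg_mem_of (P : Ideal (Rg A B)) (hP : P.IsPrime) (r h : Rg A B)
    (hD : ∀ D, h.1 D ≠ 0 → r.1 D ≠ 0) (hr : r ∈ P) : h ∈ P := by
  obtain ⟨N, hN⟩ := Rg_dvd r h hD
  exact hP.mem_of_pow_mem N (P.mem_of_dvd hN hr)

open Classical in
variable (A) in
/-- The variables as elements of the ring. -/
def Xr (m : B) : Rg A B :=
  ⟨fun D => if m ∈ D then xv m else 0, by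
    refine ⟨fun C D h => ?_, {m}, fun D D' h => ?_⟩
    · by_cases hC : m ∈ C
      · simp only [hC, h hC, if_true]
        exact ⟨_, sig_xv_mem hC, by simp⟩
      · by_cases hD : m ∈ D
        · simp only [hC, hD, if_true, if_false]
          exact ⟨_, sig_xv_notMem hC, by simp⟩
        · simp only [hC, hD, if_false]
          exact Lim.zero _
    · simp [h m (by simp)]⟩

lemma Xr_ne {m : B} {D : Subalgebra A B} : (Xr A m).1 D ≠ 0 ↔ m ∈ D := by
  by_cases h : m ∈ D <;> simp [Xr, h, xv_ne_zero]

lemma sum_Xr_ne {T : Finset B} {D : Subalgebra A B} {m : B} (hm : m ∈ T) (hD : m ∈ D) :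
    (∑ i ∈ T, Xr A i).1 D ≠ 0 := by
  classical
  have : (∑ i ∈ T, Xr A i).1 D =
      algebraMap (MvPolynomial B ℚ) (KF B) (∑ i ∈ T, if i ∈ D then MvPolynomial.X i else 0) := by
    rw [map_sum, AddSubmonoidClass.coe_finsetSum, Finset.sum_apply]
    refine Finset.sum_congr rfl fun i _ => ?_
    by_cases h : i ∈ D <;> simp [Xr, h, xv]
  rw [this, Ne, FaithfulSMul.algebraMap_eq_zero_iff]
  intro h0
  have h1 := congrArg (MvPolynomial.eval (Pi.single m (1 : ℚ))) h0
  rw [map_sum, Finset.sum_eq_single m] at h1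
  · simp [hD] at h1
  · intro b _ hb
    by_cases h : b ∈ D <;> simp [h, hb]
  · exact fun h => (h hm).elim

lemma Rg_open (r : Rg A B) (C : Subalgebra A B) (hC : r.1 C ≠ 0) (F : Finset B)
    (hF : ∀ D D' : Subalgebra A B, (∀ m ∈ F, m ∈ D ↔ m ∈ D') → r.1 D = r.1 D')
    (D : Subalgebra A B) (hD : ∀ m ∈ F, m ∈ C → m ∈ D) : r.1 D ≠ 0 := by
  let E : Subalgebra A B := C ⊓ D
  refine Rg_up r (C := E) inf_le_right ?_
  rw [hF E C]
  · exact hC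
  · intro m hm
    exact ⟨fun h => h.1, fun h => ⟨h, hD m hm h⟩⟩

variable (A B) in
/-- The map to the spectrum. -/
def toSpec (C : Subalgebra A B) : PrimeSpectrum (Rg A B) :=
  ⟨RingHom.ker ((Pi.evalRingHom (fun _ : Subalgebra A B => KF B) C).comp (Rg A B).subtype),
    RingHom.ker_isPrime _⟩

lemma mem_toSpec {C : Subalgebra A B} {r : Rg A B} :
    r ∈ (toSpec A B C).asIdeal ↔ r.1 C = 0 := Iff.rfl

lemma toSpec_inj : Function.Injective (toSpec A B) := by
  intro C D h
  ext m
  rw [← Xr_ne, ← Xr_ne, Ne, Ne, ← mem_toSpec, ← mem_toSpec, h]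

lemma toSpec_surj : Function.Surjective (toSpec A B) := by
  classical
  intro P
  have hP := P.isPrime
  let C : Subalgebra A B :=
    { carrier := {m | Xr A m ∉ P.asIdeal}
      mul_mem' := by
        intro a b ha hb hab
        have := Rg_mem_of _ hP (Xr A (a * b)) (Xr A a * Xr A b) (fun D hD => by
          have hD' : (Xr A a).1 D * (Xr A b).1 D ≠ 0 := hD
          rw [mul_ne_zero_iff, Xr_ne, Xr_ne] at hD'
          exact Xr_ne.2 (mul_mem hD'.1 hD'.2)) hab
        exact (hP.mem_or_mem this).elim ha hb
      add_mem' := by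
        intro a b ha hb hab
        have := Rg_mem_of _ hP (Xr A (a + b)) (Xr A a * Xr A b) (fun D hD => by
          have hD' : (Xr A a).1 D * (Xr A b).1 D ≠ 0 := hD
          rw [mul_ne_zero_iff, Xr_ne, Xr_ne] at hD'
          exact Xr_ne.2 (add_mem hD'.1 hD'.2)) hab
        exact (hP.mem_or_mem this).elim ha hb
      algebraMap_mem' := by
        intro a ha
        have := Rg_mem_of _ hP (Xr A (algebraMap A B a)) 1
          (fun D _ => Xr_ne.2 (D.algebraMap_mem a)) ha
        exact hP.ne_top ((Ideal.eq_top_iff_one _).2 this) }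
  have memC : ∀ m, m ∈ C ↔ Xr A m ∉ P.asIdeal := fun m => Iff.rfl
  refine ⟨C, ?_⟩
  apply PrimeSpectrum.ext
  ext r
  rw [mem_toSpec]
  obtain ⟨F, hF⟩ := r.2.2
  constructor
  · intro hr
    have hg : (∑ i ∈ F.filter (· ∉ C), Xr A i) ∈ P.asIdeal := by
      refine Ideal.sum_mem _ fun i hi => ?_
      by_contra h
      exact (Finset.mem_filter.1 hi).2 ((memC i).2 h)
    refine Rg_mem_of _ hP _ r (fun D hD => ?_) hg
    by_contra h0
    refine Rg_open r D hD F hF C (fun m hm hmD => ?_) hr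
    by_contra hmC
    exact sum_Xr_ne (Finset.mem_filter.2 ⟨hm, hmC⟩) hmD h0
  · intro hr
    by_contra hC
    have : (∏ i ∈ F.filter (· ∈ C), Xr A i) ∈ P.asIdeal := by
      refine Rg_mem_of _ hP r _ (fun D hD => ?_) hr
      refine Rg_open r C hC F hF D (fun m hm hmC => ?_)
      rw [SubmonoidClass.coe_finsetProd, Finset.prod_apply, Finset.prod_ne_zero_iff] at hD
      exact Xr_ne.1 (hD m (Finset.mem_filter.2 ⟨hm, hmC⟩))
    obtain ⟨i, hi, hiP⟩ := (hP.prod_mem_iff).1 this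
    exact (memC i).1 (Finset.mem_filter.1 hi).2 hiP

lemma spectral_aux : IsSpectral (TopologicalSpace.generateFrom
      {S : Set (Subalgebra A B) | ∃ x : B, S = {D : Subalgebra A B | x ∈ D}}) := by
  letI t : TopologicalSpace (Subalgebra A B) := TopologicalSpace.generateFrom
      {S : Set (Subalgebra A B) | ∃ x : B, S = {D : Subalgebra A B | x ∈ D}}
  refine ⟨Rg A B, inferInstance, ⟨?_⟩⟩
  refine Equiv.toHomeomorphOfIsInducing
    (Equiv.ofBijective (toSpec A B) ⟨toSpec_inj, toSpec_surj⟩) ⟨le_antisymm ?_ ?_⟩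
  · rw [← continuous_iff_le_induced]
    refine PrimeSpectrum.isTopologicalBasis_basic_opens.continuous_iff.2 ?_
    rintro _ ⟨r, rfl⟩
    obtain ⟨F, hF⟩ := r.2.2
    rw [isOpen_iff_forall_mem_open]
    intro C hC
    have hC' : r.1 C ≠ 0 := hC
    refine ⟨⋂ m ∈ {m | m ∈ F ∧ m ∈ C}, {D : Subalgebra A B | m ∈ D}, ?_, ?_, ?_⟩
    · intro D hD
      have : r.1 D ≠ 0 := Rg_open r C hC' F hF D (fun m hm hmC => by
        have := Set.mem_iInter₂.1 hD m ⟨hm, hmC⟩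
        exact this)
      exact this
    · refine Set.Finite.isOpen_biInter (F.finite_toSet.subset fun m hm => hm.1) fun m _ => ?_
      exact TopologicalSpace.isOpen_generateFrom_of_mem ⟨m, rfl⟩
    · exact Set.mem_iInter₂.2 fun m hm => hm.2
  · refine le_generateFrom ?_
    rintro _ ⟨m, rfl⟩
    rw [isOpen_induced_iff]
    refine ⟨_, (PrimeSpectrum.basicOpen (Xr A m)).2, ?_⟩
    ext D
    exact Xr_ne

end SpecRing

/-- Let `B` be a (commutative) ring extension of `A`, and let `S(B|A)` be the set of all
intermediate rings (formalized as the `A`-subalgebras of `B`), endowed with the Zariski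
topology, having the sets `U_x = {C ∈ S(B|A) : x ∈ C}`, for `x ∈ B`, as a subbasis of open
sets.  Then: (1) for every subset `Y ⊆ S(B|A)` and every ultrafilter `𝒰` on `Y`, the set
`A_𝒰 = {x ∈ B : U_x ∩ Y ∈ 𝒰}` is an intermediate ring, i.e. belongs to `S(B|A)`;
(2) `S(B|A)` with the Zariski topology is a spectral space. -/
theorem stmt17 {A : Type u} {B : Type v} [CommRing A] [CommRing B] [Algebra A B] :
    (∀ (Y : Set (Subalgebra A B)) (𝒰 : Ultrafilter Y),
      ∃ C : Subalgebra A B,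
        (C : Set B) =
          {x : B | (Subtype.val ⁻¹' {D : Subalgebra A B | x ∈ D} : Set Y) ∈ 𝒰}) ∧
    IsSpectral (TopologicalSpace.generateFrom
      {S : Set (Subalgebra A B) | ∃ x : B, S = {D : Subalgebra A B | x ∈ D}}) := by
  constructor
  · intro Y 𝒰
    refine ⟨{ carrier := {x : B | (Subtype.val ⁻¹' {D : Subalgebra A B | x ∈ D} : Set Y) ∈ 𝒰}
              mul_mem' := ?_
              add_mem' := ?_
              algebraMap_mem' := ?_ }, rfl⟩
    · intro a b ha hb
      exact Filter.mem_of_superset (Filter.inter_mem ha hb) fun D hD => D.1.mul_mem hD.1 hD.2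
    · intro a b ha hb
      exact Filter.mem_of_superset (Filter.inter_mem ha hb) fun D hD => D.1.add_mem hD.1 hD.2
    · intro a
      exact Filter.mem_of_superset Filter.univ_mem fun D _ => D.1.algebraMap_mem a
  · exact spectral_aux
end

section
/- Let B|A be an extension of commutative rings with identity and let I(B|A) be the set of all intermediate rings C with A ⊆ C ⊆ B such that C is integrally closed in B, endowed with the topology induced from the Zariski topology of S(B|A) (i.e., with subbasis the sets U_x ∩ I(B|A) for x ∈ B, where U_x := {C : x ∈ C}). Then: (1) for every subset Y of I(B|A) and every ultrafilter 𝒰 on Y, the ring A_𝒰 := {x ∈ B : U_x ∩ Y ∈ 𝒰} is an intermediate ring that is integrally closed in B, hence belongs to I(B|A); (2) I(B|A) with this topology is a spectral space. -/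
open Set

universe u v

namespace SpecConstr

abbrev L (B : Type v) := FractionRing (MvPolynomial B ℚ)

noncomputable def tt {B : Type v} (b : B) : L B :=
  algebraMap (MvPolynomial B ℚ) (L B) (MvPolynomial.X b)

theorem wt_pos {a b : WithTop ℤ} (ha : 0 ≤ a) (hb : 0 < b) : 0 < a + b :=
  lt_of_lt_of_le hb (le_add_of_nonneg_left ha)

theorem wt_pos2 {a b : WithTop ℤ} (ha : 0 < a) (hb : 0 ≤ b) : 0 < a + b :=
  lt_of_lt_of_le ha (le_add_of_nonneg_right hb)

open Classical in
/-- Substitution scaling the variables outside `C` by `X`. -/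
noncomputable def psi {B : Type v} (C : Set B) :
    MvPolynomial B ℚ →+* Polynomial (L B) :=
  MvPolynomial.eval₂Hom (algebraMap ℚ _) (fun b =>
    if b ∈ C then Polynomial.C (tt b)
    else Polynomial.X * Polynomial.C (tt b))

theorem tt_ne {B : Type v} (b : B) : tt b ≠ 0 := by
  unfold tt
  rw [Ne, FaithfulSMul.algebraMap_eq_zero_iff]
  exact MvPolynomial.X_ne_zero b

theorem psi_inj {B : Type v} (C : Set B) : Function.Injective (psi C) := by
  have h : (Polynomial.evalRingHom (1 : L B)).comp (psi C) = algebraMap _ _ := by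
    apply MvPolynomial.ringHom_ext
    · intro r
      simp [psi]
      exact (eq_ratCast ((algebraMap (MvPolynomial B ℚ) (L B)).comp
        MvPolynomial.C) r).symm
    · intro b
      simp only [psi, RingHom.comp_apply, MvPolynomial.eval₂Hom_X']
      split_ifs <;> simp [tt]
  have h2 : Function.Injective ((Polynomial.evalRingHom (1 : L B)).comp (psi C)) := by
    rw [h]; exact FaithfulSMul.algebraMap_injective _ _
  exact Function.Injective.of_comp h2

noncomputable def emb (B : Type v) : Polynomial (L B) →+* HahnSeries ℤ (L B) :=
  (HahnSeries.ofPowerSeries ℤ (L B)).comp Polynomial.coeToPowerSeries.ringHom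

theorem emb_inj (B : Type v) : Function.Injective (emb B) := by
  have := (HahnSeries.ofPowerSeries_injective (Γ := ℤ) (R := L B)).comp
    (Polynomial.coe_injective (L B))
  exact this

theorem emb_C {B : Type v} (a : L B) : emb B (Polynomial.C a) = HahnSeries.C a := by
  simp [emb]

theorem emb_X {B : Type v} : emb B Polynomial.X = HahnSeries.single 1 1 := by
  simp [emb]

noncomputable def phi {B : Type v} (C : Set B) : L B →+* HahnSeries ℤ (L B) :=
  IsFractionRing.lift (A := MvPolynomial B ℚ) (g := (emb B).comp (psi C))
    ((emb_inj B).comp (psi_inj C))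

theorem phi_alg {B : Type v} (C : Set B) (p : MvPolynomial B ℚ) :
    phi C (algebraMap _ _ p) = emb B (psi C p) := by
  simp [phi]

theorem phi_mem {B : Type v} {C : Set B} {b : B} (h : b ∈ C) :
    phi C (tt b) = HahnSeries.C (tt b) := by
  conv_lhs => rw [tt, phi_alg]
  simp [psi, h, emb_C]

theorem phi_not_mem {B : Type v} {C : Set B} {b : B} (h : b ∉ C) :
    phi C (tt b) = HahnSeries.single 1 (tt b) := by
  conv_lhs => rw [tt, phi_alg]
  simp [psi, h, emb_C, emb_X, HahnSeries.C_apply]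

noncomputable def vv {B : Type v} (C : Set B) : AddValuation (L B) (WithTop ℤ) :=
  (HahnSeries.addVal ℤ (L B)).comap (phi C)

theorem vv_apply {B : Type v} (C : Set B) (a : L B) :
    vv C a = HahnSeries.addVal ℤ (L B) (phi C a) := rfl

theorem vv_const {B : Type v} {C : Set B} {a : L B} (h : phi C a = HahnSeries.C a)
    (h0 : a ≠ 0) : vv C a = 0 := by
  rw [vv_apply, h, HahnSeries.addVal_apply, HahnSeries.C_apply, HahnSeries.orderTop_single h0]
  rfl

theorem vv_not_mem {B : Type v} {C : Set B} {b : B} (h : b ∉ C) : 0 < vv C (tt b) := by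
  rw [vv_apply, phi_not_mem h, HahnSeries.addVal_apply, HahnSeries.orderTop_single (tt_ne b)]
  exact_mod_cast Int.one_pos

theorem psi_congr {B : Type v} {C D : Set B} {p : MvPolynomial B ℚ}
    (h : ∀ b ∈ p.vars, b ∈ C ↔ b ∈ D) : psi C p = psi D p := by
  unfold psi
  apply MvPolynomial.eval₂Hom_congr' rfl _ rfl
  intro b hb _
  have := h b hb
  by_cases hC : b ∈ C
  · rw [if_pos hC, if_pos (this.1 hC)]
  · rw [if_neg hC, if_neg (fun h' => hC (this.2 h'))]

theorem vv_bound {B : Type v} (a : L B) (ha : a ≠ 0) :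
    ∃ N : ℕ, ∀ C : Set B, vv C a ≤ ((N : ℤ) : WithTop ℤ) := by
  classical
  obtain ⟨p, q, hq, rfl⟩ := IsFractionRing.div_surjective (A := MvPolynomial B ℚ) a
  let F := p.vars ∪ q.vars
  have key : ∀ C : Set B, vv C (algebraMap _ (L B) p / algebraMap _ (L B) q) =
      vv (↑(F.filter (· ∈ C)) : Set B) (algebraMap _ (L B) p / algebraMap _ (L B) q) := by
    intro C
    rw [vv_apply, vv_apply, map_div₀ (phi C), map_div₀ (phi _), phi_alg, phi_alg, phi_alg, phi_alg,
      psi_congr (p := p) (D := (↑(F.filter (· ∈ C)) : Set B)),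
      psi_congr (p := q) (D := (↑(F.filter (· ∈ C)) : Set B))]
    · intro b hb
      simp [F, hb]
    · intro b hb
      simp [F, hb]
  generalize algebraMap _ (L B) p / algebraMap _ (L B) q = a at *
  refine ⟨F.powerset.sup fun G => ((vv (↑G : Set B) a).untopD 0).toNat, fun C => ?_⟩
  rw [key C]
  have h1 := Finset.le_sup (f := fun G : Finset B => ((vv (↑G : Set B) a).untopD 0).toNat)
    (Finset.mem_powerset.2 (Finset.filter_subset (· ∈ C) F))
  have h2 : vv (↑(F.filter (· ∈ C)) : Set B) a ≠ ⊤ := by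
    rw [AddValuation.ne_top_iff]; exact ha
  obtain ⟨z, hz⟩ := WithTop.ne_top_iff_exists.1 h2
  simp only [← hz, WithTop.untopD_coe] at h1
  rw [← hz]
  apply WithTop.coe_le_coe.2
  omega

/-- The ring whose spectrum realizes the space. -/
noncomputable def RR {B X : Type v} (S : X → Set B) : Subring (X → L B) where
  carrier := {h | (∃ F : Finset B, ∀ D D', (∀ b ∈ F, b ∈ S D ↔ b ∈ S D') → h D = h D') ∧
    (∀ D, phi (S D) (h D) = HahnSeries.C (h D)) ∧
    ∀ C D, S C ⊆ S D → 0 < vv (S C) (h D - h C)}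
  zero_mem' := ⟨⟨∅, by simp⟩, by simp, by simp⟩
  one_mem' := ⟨⟨∅, by simp⟩, by simp, by simp⟩
  add_mem' := by
    classical
    rintro f g ⟨⟨F, hF⟩, hf, hf'⟩ ⟨⟨G, hG⟩, hg, hg'⟩
    refine ⟨⟨F ∪ G, fun D D' h => ?_⟩, fun D => ?_, fun C D h => ?_⟩
    · rw [Pi.add_apply, Pi.add_apply, hF D D', hG D D']
      · exact fun b hb => h b (Finset.mem_union_right _ hb)
      · exact fun b hb => h b (Finset.mem_union_left _ hb)
    · rw [Pi.add_apply, map_add, map_add, hf, hg]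
    · rw [Pi.add_apply, Pi.add_apply, add_sub_add_comm]
      exact AddValuation.map_lt_add _ (hf' C D h) (hg' C D h)
  neg_mem' := by
    rintro f ⟨⟨F, hF⟩, hf, hf'⟩
    refine ⟨⟨F, fun D D' h => ?_⟩, fun D => ?_, fun C D h => ?_⟩
    · rw [Pi.neg_apply, Pi.neg_apply, hF D D' h]
    · rw [Pi.neg_apply, map_neg, map_neg, hf]
    · rw [Pi.neg_apply, Pi.neg_apply, neg_sub_neg, AddValuation.map_sub_swap]
      exact hf' C D h
  mul_mem' := by
    classical
    rintro f g ⟨⟨F, hF⟩, hf, hf'⟩ ⟨⟨G, hG⟩, hg, hg'⟩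
    refine ⟨⟨F ∪ G, fun D D' h => ?_⟩, fun D => ?_, fun C D h => ?_⟩
    · rw [Pi.mul_apply, Pi.mul_apply, hF D D', hG D D']
      · exact fun b hb => h b (Finset.mem_union_right _ hb)
      · exact fun b hb => h b (Finset.mem_union_left _ hb)
    · rw [Pi.mul_apply, map_mul, map_mul, hf, hg]
    · have nn : ∀ f : X → L B, (∀ D, phi (S D) (f D) = HahnSeries.C (f D)) →
          0 ≤ vv (S C) (f C) := by
        intro f hf
        by_cases h0 : f C = 0
        · simp [h0]
        · rw [vv_const (hf C) h0]
      have e : (f * g) D - (f * g) C =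
          (f D - f C) * (g D - g C) + (f C * (g D - g C) + (f D - f C) * g C) := by
        simp only [Pi.mul_apply]; ring
      rw [e]
      refine AddValuation.map_lt_add _ ?_ (AddValuation.map_lt_add _ ?_ ?_)
      · rw [AddValuation.map_mul]
        exact wt_pos2 (hf' C D h) (hg' C D h).le
      · rw [AddValuation.map_mul]
        exact wt_pos (nn f hf) (hg' C D h)
      · rw [AddValuation.map_mul]
        exact wt_pos2 (hf' C D h) (nn g hg)

theorem vv_up {B X : Type v} {S : X → Set B} {h : X → L B} (hh : h ∈ RR S) {C D : X}
    (hCD : S C ⊆ S D) (h0 : h C ≠ 0) : vv (S C) (h D) = 0 := by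
  have h1 := vv_const (hh.2.1 C) h0
  have h2 := hh.2.2 C D hCD
  have e : h D = h C + (h D - h C) := by ring
  rw [e, AddValuation.map_add_eq_of_lt_left _ (by rw [h1]; exact h2), h1]

theorem ne_up {B X : Type v} {S : X → Set B} {h : X → L B} (hh : h ∈ RR S) {C D : X}
    (hCD : S C ⊆ S D) (h0 : h C ≠ 0) : h D ≠ 0 := by
  intro h1
  have := vv_up hh hCD h0
  rw [h1] at this
  simp at this

open Classical in
noncomputable def te {B X : Type v} (S : X → Set B) (b : B) : RR S :=
  ⟨fun D => if b ∈ S D then tt b else 0, by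
    refine ⟨⟨{b}, fun D D' h => ?_⟩, fun D => ?_, fun C D h => ?_⟩
    · have := h b (by simp)
      simp [this]
    · dsimp only
      split_ifs with hb
      · exact phi_mem hb
      · simp
    · dsimp only
      by_cases hC : b ∈ S C
      · simp [hC, h hC]
      · by_cases hD : b ∈ S D
        · simp [hC, hD, vv_not_mem]
        · simp [hC, hD]⟩

theorem te_ne {B X : Type v} {S : X → Set B} {b : B} {D : X} :
    (te S b).1 D ≠ 0 ↔ b ∈ S D := by
  simp [te, tt_ne]

theorem dvd_pow' {B X : Type v} {S : X → Set B} (f g : RR S)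
    (H : ∀ D, f.1 D ≠ 0 → g.1 D ≠ 0) : ∃ n : ℕ, g ∣ f ^ n := by
  classical
  obtain ⟨f, hf⟩ := f
  obtain ⟨g, hg⟩ := g
  dsimp only at H
  have hb : ∃ N : ℕ, ∀ C D, g D ≠ 0 → vv (S C) (g D) ≤ ((N : ℤ) : WithTop ℤ) := by
    obtain ⟨F, hF⟩ := hg.1
    have hfin : (Set.range g).Finite := by
      have hr : (Set.range fun D : X => F.filter (· ∈ S D)).Finite :=
        (Finset.finite_toSet F.powerset).subset (by
          rintro _ ⟨D, rfl⟩
          exact Finset.mem_powerset.2 (Finset.filter_subset _ _))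
      have hfac : Function.FactorsThrough g (fun D : X => F.filter (· ∈ S D)) := by
        intro D D' h
        apply hF
        intro b hb
        have := congrArg (b ∈ ·) h
        simpa [hb] using this
      rw [← hfac.extend_comp (e' := fun _ => 0), Set.range_comp]
      exact hr.image _
    have hN : ∀ a : L B, ∃ N : ℕ, a ≠ 0 → ∀ C : Set B, vv C a ≤ ((N : ℤ) : WithTop ℤ) := by
      intro a
      by_cases ha : a = 0
      · exact ⟨0, fun h => absurd ha h⟩
      · obtain ⟨N, hN⟩ := vv_bound a ha
        exact ⟨N, fun _ => hN⟩
    choose N hN using hN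
    refine ⟨hfin.toFinset.sup N, fun C D h => (hN _ h _).trans ?_⟩
    have : N (g D) ≤ hfin.toFinset.sup N := Finset.le_sup (by simp)
    exact_mod_cast this
  obtain ⟨N, hN⟩ := hb
  have hfn : f ^ (N + 1) ∈ RR S := pow_mem hf _
  refine ⟨N + 1, ⟨fun D => f D ^ (N + 1) / g D, ?_, ?_, ?_⟩, ?_⟩
  · obtain ⟨F, hF⟩ := hf.1
    obtain ⟨G, hG⟩ := hg.1
    refine ⟨F ∪ G, fun D D' h => ?_⟩
    dsimp only
    rw [hF D D', hG D D']
    · exact fun b hb => h b (Finset.mem_union_right _ hb)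
    · exact fun b hb => h b (Finset.mem_union_left _ hb)
  · intro D
    dsimp only
    rw [map_div₀, map_div₀, map_pow, map_pow, hf.2.1, hg.2.1]
  · intro C D hCD
    dsimp only
    by_cases hC : g C = 0
    · have hfC : f C = 0 := by
        by_contra h; exact H C h hC
      by_cases hD : g D = 0
      · simp [hC, hD]
      · rw [hC, div_zero, sub_zero]
        have h1 := hf.2.2 C D hCD
        rw [hfC, sub_zero] at h1
        have h2 := hN C D hD
        have e : vv (S C) (f D ^ (N + 1) / g D) + vv (S C) (g D) =
            (N + 1) • vv (S C) (f D) := by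
          rw [← AddValuation.map_mul, div_mul_cancel₀ _ hD, AddValuation.map_pow]
        have h3 : ((N + 1 : ℤ) : WithTop ℤ) ≤ (N + 1) • vv (S C) (f D) := by
          generalize vv (S C) (f D) = y at h1
          induction y using WithTop.recTopCoe with
          | top => rw [succ_nsmul]; simp
          | coe y =>
            have : 0 < y := by exact_mod_cast h1
            have h5 : (N + 1 : ℤ) ≤ (N + 1) • y := by
              rw [nsmul_eq_mul]; push_cast; nlinarith
            exact_mod_cast h5
        rw [← e] at h3
        generalize vv (S C) (f D ^ (N + 1) / g D) = x at *
        generalize vv (S C) (g D) = y at *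
        induction y using WithTop.recTopCoe with
        | top => simp at h2
        | coe y =>
          induction x using WithTop.recTopCoe with
          | top => simp
          | coe x =>
            norm_cast at *
            omega
    · have hD : g D ≠ 0 := ne_up hg hCD hC
      have e : (f D ^ (N + 1) / g D - f C ^ (N + 1) / g C) * (g D * g C) =
          (f D ^ (N + 1) - f C ^ (N + 1)) * g C - f C ^ (N + 1) * (g D - g C) := by
        field_simp
        ring
      have e2 := congrArg (vv (S C)) e
      rw [AddValuation.map_mul, AddValuation.map_mul, vv_up hg hCD hC,
        vv_const (hg.2.1 C) hC, add_zero, add_zero] at e2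
      rw [e2]
      refine lt_of_lt_of_le (lt_min ?_ ?_) (AddValuation.map_sub _ _ _)
      · rw [AddValuation.map_mul, vv_const (hg.2.1 C) hC, add_zero]
        exact hfn.2.2 C D hCD
      · rw [AddValuation.map_mul]
        refine wt_pos ?_ (hg.2.2 C D hCD)
        by_cases h0 : f C ^ (N + 1) = 0
        · simp [h0]
        · exact (vv_const (hfn.2.1 C) h0).ge
  · ext D
    change f D ^ (N + 1) = g D * (f D ^ (N + 1) / g D)
    by_cases hD : g D = 0
    · have hfD : f D = 0 := by
        by_contra h; exact H D h hD
      simp [hD, hfD]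
    · field_simp

end SpecConstr

namespace SpecConstr

/-- The point of the spectrum given by vanishing at `C`. -/
noncomputable def pt {B X : Type v} (S : X → Set B) (C : X) : PrimeSpectrum (RR S) :=
  ⟨RingHom.ker ((Pi.evalRingHom (fun _ : X => L B) C).comp (RR S).subtype),
    RingHom.ker_isPrime _⟩

theorem mem_pt {B X : Type v} {S : X → Set B} {C : X} {h : RR S} :
    h ∈ (pt S C).asIdeal ↔ h.1 C = 0 := Iff.rfl

/-- The closure condition. -/
def Closed {B X : Type v} (S : X → Set B) : Prop :=
  ∀ C : Set B, (∀ F : Finset B, ↑F ⊆ C → ∀ x, (∀ D, ↑F ⊆ S D → x ∈ S D) → x ∈ C) →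
    ∃ c : X, S c = C

theorem Closed.cl {B X : Type v} {S : X → Set B} (hS : Closed S) (F : Set B) :
    ∃ c : X, F ⊆ S c ∧ ∀ D, F ⊆ S D → S c ⊆ S D := by
  obtain ⟨c, hc⟩ := hS {x | ∀ D, F ⊆ S D → x ∈ S D} (by
    intro G hG x hx D hD
    exact hx D (fun y hy => hG hy D hD))
  refine ⟨c, ?_, ?_⟩
  · rw [hc]; intro x hx D hD; exact hD hx
  · intro D hD x hx
    rw [hc] at hx
    exact hx D hD

theorem prod_ne {B X : Type v} {S : X → Set B} {F : Finset B} {D : X} :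
    (∏ b ∈ F, te S b).1 D ≠ 0 ↔ ↑F ⊆ S D := by
  have : (∏ b ∈ F, te S b).1 D = ∏ b ∈ F, (te S b).1 D :=
    map_prod ((Pi.evalRingHom (fun _ : X => L B) D).comp (RR S).subtype) _ _
  rw [this, Finset.prod_ne_zero_iff]
  simp only [te_ne]
  rfl

theorem sum_ne {B X : Type v} {S : X → Set B} {F : Finset B} {D : X} {b : B} (hb : b ∈ F)
    (hD : b ∈ S D) : (∑ b ∈ F, te S b).1 D ≠ 0 := by
  classical
  have h1 : (∑ b ∈ F, te S b).1 D = ∑ b ∈ F, (te S b).1 D :=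
    map_sum ((Pi.evalRingHom (fun _ : X => L B) D).comp (RR S).subtype) _ _
  have h2 : (∑ b ∈ F, te S b).1 D =
      algebraMap (MvPolynomial B ℚ) (L B) (∑ b ∈ F with b ∈ S D, MvPolynomial.X b) := by
    rw [h1, map_sum, Finset.sum_filter]
    apply Finset.sum_congr rfl
    intro c _
    simp only [te, tt]
  rw [h2, Ne, FaithfulSMul.algebraMap_eq_zero_iff]
  intro h3
  have h4 := congrArg (MvPolynomial.eval (fun c => if c = b then (1 : ℚ) else 0)) h3
  simp [hb, hD] at h4

/-- A function of the ring nonzero at `C` is nonzero on a basic neighbourhood of `C`. -/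
theorem nhd {B X : Type v} {S : X → Set B} (hS : Closed S) (h : RR S) (C : X)
    (h0 : h.1 C ≠ 0) : ∃ F : Finset B, ↑F ⊆ S C ∧ ∀ D, ↑F ⊆ S D → h.1 D ≠ 0 := by
  classical
  obtain ⟨G, hG⟩ := h.2.1
  refine ⟨G.filter (· ∈ S C), fun b hb => (Finset.mem_filter.1 hb).2, fun D hD => ?_⟩
  obtain ⟨c, hc, hc'⟩ := hS.cl (↑(G.filter (· ∈ S C)) : Set B)
  have hcC : S c ⊆ S C := hc' C (fun b hb => (Finset.mem_filter.1 hb).2)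
  have e : h.1 c = h.1 C := hG c C (fun b hb =>
    ⟨fun hx => hcC hx, fun hx => hc (Finset.mem_filter.2 ⟨hb, hx⟩)⟩)
  exact ne_up h.2 (hc' D hD) (by rw [e]; exact h0)

theorem pt_surj {B X : Type v} {S : X → Set B} (hS : Closed S) :
    Function.Surjective (pt S) := by
  classical
  intro Q
  have hQ := Q.isPrime
  have hprod : ∀ F : Finset B, (∀ b ∈ F, te S b ∉ Q.asIdeal) →
      ∏ b ∈ F, te S b ∉ Q.asIdeal := by
    intro F hF h
    obtain ⟨b, hb, hb'⟩ := (Ideal.IsPrime.prod_mem_iff).1 h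
    exact hF b hb hb'
  have hdvd : ∀ f g : RR S, (∀ D, f.1 D ≠ 0 → g.1 D ≠ 0) → g ∈ Q.asIdeal → f ∈ Q.asIdeal := by
    intro f g H hg
    obtain ⟨n, hn⟩ := dvd_pow' f g H
    exact hQ.mem_of_pow_mem n (Q.asIdeal.mem_of_dvd hn hg)
  obtain ⟨C, hC⟩ := hS {b | te S b ∉ Q.asIdeal} (by
    intro F hF x hx hmem
    refine hprod F (fun b hb => hF hb) (hdvd _ _ ?_ hmem)
    intro D hD
    exact te_ne.2 (hx D (prod_ne.1 hD)))
  have hC' : ∀ b, b ∈ S C ↔ te S b ∉ Q.asIdeal := fun b => by rw [hC]; rfl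
  refine ⟨C, ?_⟩
  apply PrimeSpectrum.ext
  ext h
  rw [mem_pt]
  constructor
  · intro h0
    obtain ⟨G, hG⟩ := h.2.1
    set F := G.filter (· ∈ S C) with hF
    have hFQ : ∏ b ∈ F, te S b ∉ Q.asIdeal :=
      hprod F (fun b hb => (hC' b).1 (Finset.mem_filter.1 hb).2)
    have hsum : ∑ b ∈ G with b ∉ S C, te S b ∈ Q.asIdeal := by
      refine Ideal.sum_mem _ (fun b hb => ?_)
      by_contra hh
      exact (Finset.mem_filter.1 hb).2 ((hC' b).2 hh)
    have : h * ∏ b ∈ F, te S b ∈ Q.asIdeal := by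
      refine hdvd _ _ ?_ hsum
      intro D hD
      have hD' : h.1 D * (∏ b ∈ F, te S b).1 D ≠ 0 := hD
      have h1 := left_ne_zero_of_mul hD'
      have h2 := prod_ne.1 (right_ne_zero_of_mul hD')
      by_contra hcon
      apply h1
      rw [← h0]
      apply hG
      intro b hb
      constructor
      · intro hbD
        by_contra hbC
        exact sum_ne (Finset.mem_filter.2 ⟨hb, hbC⟩) hbD hcon
      · intro hbC
        exact h2 (Finset.mem_filter.2 ⟨hb, hbC⟩)
    exact (hQ.mem_or_mem this).resolve_right hFQ
  · intro hh
    by_contra h0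
    obtain ⟨F, hF, hF'⟩ := nhd hS h C h0
    refine hprod F (fun b hb => (hC' b).1 (hF hb)) (hdvd _ _ ?_ hh)
    intro D hD
    exact hF' D (prod_ne.1 hD)

theorem pt_inj {B X : Type v} {S : X → Set B} (hinj : Function.Injective S) :
    Function.Injective (pt S) := by
  intro C D h
  apply hinj
  ext b
  rw [← te_ne (S := S), ← te_ne (S := S), Ne, Ne, ← mem_pt, ← mem_pt, h]

theorem isSpectral {B X : Type v} {S : X → Set B} (hS : Closed S)
    (hinj : Function.Injective S) :
    IsSpectral (TopologicalSpace.generateFrom {s : Set X | ∃ b : B, s = {D | b ∈ S D}}) := by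
  letI t : TopologicalSpace X :=
    TopologicalSpace.generateFrom {s : Set X | ∃ b : B, s = {D | b ∈ S D}}
  have hopen : ∀ b : B, IsOpen {D : X | b ∈ S D} := fun b =>
    TopologicalSpace.isOpen_generateFrom_of_mem ⟨b, rfl⟩
  have hcont : Continuous (pt S) := by
    rw [PrimeSpectrum.isTopologicalBasis_basic_opens.continuous_iff]
    rintro _ ⟨h, rfl⟩
    rw [isOpen_iff_forall_mem_open]
    intro C hC
    obtain ⟨F, hF, hF'⟩ := nhd hS h C hC
    refine ⟨⋂ b ∈ F, {D | b ∈ S D}, ?_, isOpen_biInter_finset fun b _ => hopen b, ?_⟩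
    · intro D hD
      simp only [Set.mem_iInter] at hD
      exact hF' D (fun b hb => hD b hb)
    · simp only [Set.mem_iInter]
      exact fun b hb => hF hb
  have hind : Topology.IsInducing (pt S) := by
    refine ⟨le_antisymm hcont.le_induced ?_⟩
    apply le_generateFrom
    rintro _ ⟨b, rfl⟩
    refine ⟨_, (PrimeSpectrum.basicOpen (te S b)).isOpen, ?_⟩
    ext D
    exact te_ne
  exact ⟨RR S, inferInstance,
    ⟨(Equiv.ofBijective (pt S) ⟨pt_inj hinj, pt_surj hS⟩).toHomeomorphOfIsInducing hind⟩⟩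

end SpecConstr

theorem closed_aux {A : Type u} {B : Type v} [CommRing A] [CommRing B] [Algebra A B]
    (C : Set B) (H : ∀ F : Finset B, ↑F ⊆ C → ∀ x,
      (∀ D : Subalgebra A B, (∀ x : B, IsIntegral D x → x ∈ D) → (F : Set B) ⊆ D → x ∈ D) →
        x ∈ C) :
    ∃ E : Subalgebra A B, (∀ x : B, IsIntegral E x → x ∈ E) ∧ (E : Set B) = C := by
  classical
  refine ⟨{ carrier := C
            mul_mem' := ?_
            add_mem' := ?_
            algebraMap_mem' := ?_ }, ?_, rfl⟩
  · intro a b ha hb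
    refine H {a, b} ?_ _ fun D _ hD => ?_
    · intro x hx
      simp at hx
      rcases hx with rfl | rfl <;> assumption
    · exact D.mul_mem (hD (by simp)) (hD (by simp))
  · intro a b ha hb
    refine H {a, b} ?_ _ fun D _ hD => ?_
    · intro x hx
      simp at hx
      rcases hx with rfl | rfl <;> assumption
    · exact D.add_mem (hD (by simp)) (hD (by simp))
  · intro r
    exact H ∅ (by simp) _ fun D _ _ => D.algebraMap_mem r
  · rintro x ⟨p, hp, hpx⟩
    refine H (p.support.image fun i => (p.coeff i : B)) ?_ _ fun D hD hF => ?_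
    · intro y hy
      simp only [Finset.coe_image, Set.mem_image] at hy
      obtain ⟨i, _, rfl⟩ := hy
      exact (p.coeff i).2
    · rcases subsingleton_or_nontrivial B with hs | hs
      · rw [Subsingleton.elim x 0]
        exact D.zero_mem
      apply hD
      have hl : p.map (algebraMap _ B) ∈ Polynomial.lifts (algebraMap D B) := by
        rw [Polynomial.lifts_iff_coeff_lifts]
        intro i
        rw [Polynomial.coeff_map]
        by_cases hi : p.coeff i = 0
        · exact ⟨0, by rw [hi, map_zero, map_zero]⟩
        · exact ⟨⟨(p.coeff i : B), hF (by
            rw [Finset.mem_coe]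
            exact Finset.mem_image_of_mem _ (Polynomial.mem_support_iff.2 hi))⟩, rfl⟩
      obtain ⟨q, hq, _, hqm⟩ := Polynomial.lifts_and_degree_eq_and_monic hl (hp.map _)
      refine ⟨q, hqm, ?_⟩
      rw [← Polynomial.eval_map, hq, Polynomial.eval_map]
      exact hpx

/-- Let `B` be a (commutative) ring extension of `A` and let `I(B|A)` be the set of all
intermediate rings (formalized as `A`-subalgebras of `B`) that are integrally closed in `B`,
with the topology induced by the Zariski topology of `S(B|A)`, i.e. generated by the subbasis
of the sets `U_x ∩ I(B|A)`, for `x ∈ B`, where `U_x = {C : x ∈ C}`.  Then: (1) for every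
subset `Y ⊆ I(B|A)` and every ultrafilter `𝒰` on `Y`, the set `A_𝒰 = {x ∈ B : U_x ∩ Y ∈ 𝒰}`
is an intermediate ring integrally closed in `B`, hence belongs to `I(B|A)`; (2) `I(B|A)` with
this topology is a spectral space. -/
theorem stmt18 {A : Type u} {B : Type v} [CommRing A] [CommRing B] [Algebra A B] :
    (∀ Y : Set (Subalgebra A B),
      Y ⊆ {C : Subalgebra A B | ∀ x : B, IsIntegral C x → x ∈ C} →
      ∀ 𝒰 : Ultrafilter Y,
        ∃ C : Subalgebra A B, (∀ x : B, IsIntegral C x → x ∈ C) ∧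
          (C : Set B) =
            {x : B | (Subtype.val ⁻¹' {D : Subalgebra A B | x ∈ D} : Set Y) ∈ 𝒰}) ∧
    IsSpectral (TopologicalSpace.generateFrom
      {S : Set {C : Subalgebra A B // ∀ x : B, IsIntegral C x → x ∈ C} |
        ∃ x : B, S = {D : {C : Subalgebra A B // ∀ x : B, IsIntegral C x → x ∈ C} | x ∈ D.1}}) := by
  refine ⟨?_, ?_⟩
  · intro Y hY 𝒰
    apply closed_aux
    intro F hF x hx
    have h1 : (⋂ b ∈ F, (Subtype.val ⁻¹' {D : Subalgebra A B | b ∈ D} : Set Y)) ∈ 𝒰 :=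
      (Filter.biInter_finset_mem F).2 fun b hb => hF hb
    refine Filter.mem_of_superset h1 ?_
    intro D hD
    simp only [Set.mem_iInter] at hD
    exact hx D.1 (hY D.2) (fun b hb => hD b hb)
  · refine SpecConstr.isSpectral
      (S := fun D : {C : Subalgebra A B // ∀ x : B, IsIntegral C x → x ∈ C} => (D.1 : Set B))
      ?_ ?_
    · intro C H
      obtain ⟨E, hE, hE'⟩ := closed_aux (A := A) C (fun F hF x hx =>
        H F hF x (fun D hD => hx D.1 D.2 hD))
      exact ⟨⟨E, hE⟩, hE'⟩
    · intro C D h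
      exact Subtype.ext (SetLike.coe_injective h)
end
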